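/- arXiv:2006.12467 — 6 statements merged into one kernel-verified Lean document; each statement's English description precedes it below -/
import Mathlib

section
/- For any even N > 1, any depth L ≥ 1, any output position i ∈ [N] and output coordinate p ∈ [d_x], and any weight configuration Θ, the separation rank of the self-attention network output y_p^{i,L,d_x,H,Θ} with respect to balanced partitions is invariant to the identity of the partition: for all disjoint A, B with A ∪ B = [N], |A| = |B| = N/2, and all disjoint Ã, B̃ with Ã ∪ B̃ = [N], |Ã| = |B̃| = N/2, it holds that sep(y_p^{i,L,d_x,H,Θ}; A, B) = sep(y_p^{i,L,d_x,H,Θ}; Ã, B̃). -/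
open scoped BigOperators
open MeasureTheory Matrix

set_option synthInstance.maxSize 4000

/-- Per-head weights `(W^K, W^Q, W^V, W^O)`, stored as plain arrays of reals so that the
weight space carries its natural (Lebesgue) `MeasureSpace` structure. -/
abbrev HeadWeights (da dx : ℕ) : Type :=
  (Fin da → Fin dx → ℝ) × (Fin da → Fin dx → ℝ) ×
  (Fin da → Fin dx → ℝ) × (Fin dx → Fin da → ℝ)

/-- The weight configuration Θ of a depth-`L`, `H`-headed self-attention network,
a point of `ℝ^{4·L·H·d_a·d_x}` (carrying Lebesgue measure `volume`). -/
abbrev SAWeights (L H da dx : ℕ) : Type := Fin L → Fin H → HeadWeights da dx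

/-- A single (multi-headed) self-attention layer:
`y^i = Σ_{j=1}^N Σ_{h=1}^H ⟨W^{Q,h} x^i, W^{K,h} x^j⟩ W^{O,h} W^{V,h} x^j`. -/
noncomputable def saLayer {N H da dx : ℕ} (W : Fin H → HeadWeights da dx)
    (x : Fin N → Fin dx → ℝ) : Fin N → Fin dx → ℝ := fun i =>
  ∑ j : Fin N, ∑ h : Fin H,
    (∑ a : Fin da, (Matrix.of (W h).2.1).mulVec (x i) a * (Matrix.of (W h).1).mulVec (x j) a) •
      (Matrix.of (W h).2.2.2).mulVec ((Matrix.of (W h).2.2.1).mulVec (x j))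

/-- `l`-fold composition of self-attention layers. -/
noncomputable def saNetAux {N H da dx : ℕ} (W : ℕ → Fin H → HeadWeights da dx) :
    ℕ → (Fin N → Fin dx → ℝ) → (Fin N → Fin dx → ℝ)
  | 0, x => x
  | (l + 1), x => saLayer (W l) (saNetAux W l x)

noncomputable def extendW {L H da dx : ℕ} (Θ : SAWeights L H da dx) :
    ℕ → Fin H → HeadWeights da dx := fun l =>
  if h : l < L then Θ ⟨l, h⟩ else fun _ => 0

/-- `y_p^{i,L,d_x,H,Θ}` : the `p`-th coordinate of the depth-`L` self-attention
network output at position `i`, as a scalar function of the `N` inputs. -/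
noncomputable def saOutput {H da dx : ℕ} (L N : ℕ) (Θ : SAWeights L H da dx)
    (i : Fin N) (p : Fin dx) (x : Fin N → Fin dx → ℝ) : ℝ :=
  saNetAux (extendW Θ) L x i p

/-- `f` depends only on the input vectors at positions in `A`. -/
def DependsOnlyOn {N dx : ℕ} (f : (Fin N → Fin dx → ℝ) → ℝ) (A : Finset (Fin N)) : Prop :=
  ∀ x y : Fin N → Fin dx → ℝ, (∀ j ∈ A, x j = y j) → f x = f y

/-- The separation rank of `f : (ℝ^{d_x})^N → ℝ` w.r.t. the partition `(A,B)`: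
the minimal number `R` of summands, each a product of a function of the inputs indexed
by `A` with a function of the inputs indexed by `B`, summing up to `f` (`⊤` if no
finite such decomposition exists). -/
noncomputable def sepRank {N dx : ℕ} (f : (Fin N → Fin dx → ℝ) → ℝ)
    (A B : Finset (Fin N)) : ℕ∞ :=
  sInf {R : ℕ∞ | ∃ n : ℕ, R = (n : ℕ∞) ∧
    ∃ g g' : Fin n → ((Fin N → Fin dx → ℝ) → ℝ),
      (∀ r, DependsOnlyOn (g r) A) ∧ (∀ r, DependsOnlyOn (g' r) B) ∧
      ∀ x, f x = ∑ r : Fin n, g r x * g' r x}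

/-- A self-attention layer is equivariant under permutations of the input positions. -/
theorem saLayer_comp_perm {N H da dx : ℕ} (W : Fin H → HeadWeights da dx)
    (σ : Equiv.Perm (Fin N)) (x : Fin N → Fin dx → ℝ) :
    saLayer W (x ∘ σ) = saLayer W x ∘ σ := by
  funext i
  exact Equiv.sum_comp σ fun j => ∑ h : Fin H,
    (∑ a : Fin da, (Matrix.of (W h).2.1).mulVec (x (σ i)) a *
      (Matrix.of (W h).1).mulVec (x j) a) •
        (Matrix.of (W h).2.2.2).mulVec ((Matrix.of (W h).2.2.1).mulVec (x j))

theorem saNetAux_comp_perm {N H da dx : ℕ} (W : ℕ → Fin H → HeadWeights da dx)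
    (σ : Equiv.Perm (Fin N)) (l : ℕ) (x : Fin N → Fin dx → ℝ) :
    saNetAux W l (x ∘ σ) = saNetAux W l x ∘ σ := by
  induction l with
  | zero => rfl
  | succ l ih => simp only [saNetAux, ih, saLayer_comp_perm]

theorem saOutput_comp_perm {L H da dx N : ℕ} (Θ : SAWeights L H da dx) (i : Fin N) (p : Fin dx)
    (σ : Equiv.Perm (Fin N)) (x : Fin N → Fin dx → ℝ) :
    saOutput L N Θ i p (x ∘ σ) = saOutput L N Θ (σ i) p x := by
  simp only [saOutput, saNetAux_comp_perm, Function.comp_apply]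

theorem DependsOnlyOn.comp_perm {N dx : ℕ} {g : (Fin N → Fin dx → ℝ) → ℝ}
    {A A' : Finset (Fin N)} (hg : DependsOnlyOn g A) (σ : Equiv.Perm (Fin N))
    (hσ : ∀ j ∈ A, σ j ∈ A') : DependsOnlyOn (fun x => g (x ∘ σ)) A' :=
  fun _ _ hxy => hg _ _ fun j hj => hxy (σ j) (hσ j hj)

theorem sepRank_comm {N dx : ℕ} (f : (Fin N → Fin dx → ℝ) → ℝ) (A B : Finset (Fin N)) :
    sepRank f A B = sepRank f B A := by
  have key : ∀ A B, sepRank f A B ≤ sepRank f B A := by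
    intro A B
    refine sInf_le_sInf ?_
    rintro R ⟨n, hR, g, g', hg, hg', hf⟩
    exact ⟨n, hR, g', g, hg', hg, fun x => by simp only [hf x, mul_comm]⟩
  exact le_antisymm (key A B) (key B A)

/-- If `f` is invariant under a permutation of the positions, then carrying a partition along
this permutation does not increase the separation rank. -/
theorem sepRank_le_of_perm {N dx : ℕ} {f : (Fin N → Fin dx → ℝ) → ℝ}
    {A B A' B' : Finset (Fin N)} (σ : Equiv.Perm (Fin N)) (hf : ∀ x, f (x ∘ σ) = f x)
    (hA : ∀ j ∈ A, σ j ∈ A') (hB : ∀ j ∈ B, σ j ∈ B') :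
    sepRank f A' B' ≤ sepRank f A B := by
  refine sInf_le_sInf ?_
  rintro R ⟨n, hR, g, g', hg, hg', hsum⟩
  exact ⟨n, hR, fun r x => g r (x ∘ σ), fun r x => g' r (x ∘ σ),
    fun r => (hg r).comp_perm σ hA, fun r => (hg' r).comp_perm σ hB,
    fun x => by rw [← hf x, hsum]⟩

/-- Two finite sets of the same size containing `i` are matched by a permutation fixing `i`. -/
theorem exists_perm_fixing_mem_iff {α : Type*} [Fintype α] [DecidableEq α] {A A' : Finset α}
    {i : α} (hi : i ∈ A) (hi' : i ∈ A') (hcard : A.card = A'.card) :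
    ∃ σ : Equiv.Perm α, σ i = i ∧ ∀ j, σ j ∈ A' ↔ j ∈ A := by
  let e : {x // x ∈ A} ≃ {x // x ∈ A'} := Finset.equivOfCardEq hcard
  have he : ∀ j, e.extendSubtype j ∈ A' ↔ j ∈ A := fun j =>
    ⟨fun h => by_contra fun hj => e.extendSubtype_not_mem j hj h, e.extendSubtype_mem j⟩
  refine ⟨e.extendSubtype.trans (Equiv.swap (e.extendSubtype i) i), by simp, fun j => ?_⟩
  rw [← he j, Equiv.trans_apply]
  have hei := (he i).2 hi
  by_cases h₁ : e.extendSubtype j = e.extendSubtype i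
  · simp [h₁, hi', hei]
  by_cases h₂ : e.extendSubtype j = i
  · simp [h₂, hi', hei]
  · rw [Equiv.swap_apply_of_ne_of_ne h₁ h₂]

theorem sepRank_saOutput_le_of_mem {L H da dx N : ℕ} (Θ : SAWeights L H da dx) {i : Fin N}
    (p : Fin dx) {A B A' B' : Finset (Fin N)} (hi : i ∈ A) (hi' : i ∈ A')
    (hcard : A.card = A'.card) (hAB : Disjoint A B) (hcov' : A' ∪ B' = Finset.univ) :
    sepRank (saOutput L N Θ i p) A' B' ≤ sepRank (saOutput L N Θ i p) A B := by
  obtain ⟨σ, hσi, hσ⟩ := exists_perm_fixing_mem_iff hi hi' hcard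
  refine sepRank_le_of_perm σ (fun x => by rw [saOutput_comp_perm, hσi])
    (fun j hj => (hσ j).2 hj) fun j hj => ?_
  have hmem : σ j ∈ A' ∪ B' := hcov' ▸ Finset.mem_univ _
  exact (Finset.mem_union.1 hmem).resolve_left fun h =>
    Finset.disjoint_left.1 hAB ((hσ j).1 h) hj

/-- Proposition 1 of the paper: for the depth-`L` self-attention network,
the separation rank w.r.t. balanced partitions is invariant to the identity of the
partition. -/
theorem sepRank_balanced_partition_invariant
    {L H da dx N : ℕ} (hN : 1 < N) (hNeven : Even N) (hL : 1 ≤ L)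
    (hdxda : dx = H * da)
    (Θ : SAWeights L H da dx) (i : Fin N) (p : Fin dx)
    (A B A' B' : Finset (Fin N))
    (hAB : Disjoint A B) (hABcov : A ∪ B = Finset.univ)
    (hA : A.card = N / 2) (hB : B.card = N / 2)
    (hAB' : Disjoint A' B') (hABcov' : A' ∪ B' = Finset.univ)
    (hA' : A'.card = N / 2) (hB' : B'.card = N / 2) :
    sepRank (saOutput L N Θ i p) A B = sepRank (saOutput L N Θ i p) A' B' := by
  have key : ∀ {A B A' B' : Finset (Fin N)}, Disjoint A B → A ∪ B = Finset.univ →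
      A.card = N / 2 → B.card = N / 2 → Disjoint A' B' → A' ∪ B' = Finset.univ →
      A'.card = N / 2 → B'.card = N / 2 →
      sepRank (saOutput L N Θ i p) A' B' ≤ sepRank (saOutput L N Θ i p) A B := by
    intro A B A' B' hAB hcov hA hB hAB' hcov' hA' hB'
    have hi : i ∈ A ∪ B := hcov ▸ Finset.mem_univ i
    have hi' : i ∈ A' ∪ B' := hcov' ▸ Finset.mem_univ i
    rcases Finset.mem_union.1 hi with hi | hi <;> rcases Finset.mem_union.1 hi' with hi' | hi'
    · exact sepRank_saOutput_le_of_mem Θ p hi hi' (hA.trans hA'.symm) hAB hcov'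
    · rw [sepRank_comm _ A' B']
      exact sepRank_saOutput_le_of_mem Θ p hi hi' (hA.trans hB'.symm) hAB
        (Finset.union_comm A' B' ▸ hcov')
    · rw [sepRank_comm _ A B]
      exact sepRank_saOutput_le_of_mem Θ p hi hi' (hB.trans hA'.symm) hAB.symm hcov'
    · rw [sepRank_comm _ A' B', sepRank_comm _ A B]
      exact sepRank_saOutput_le_of_mem Θ p hi hi' (hB.trans hB'.symm) hAB.symm
        (Finset.union_comm A' B' ▸ hcov')
  exact le_antisymm (key hAB' hABcov' hA' hB' hAB hABcov hA hB)
    (key hAB hABcov hA hB hAB' hABcov' hA' hB')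
end

section
/- Let N > 1 be even, L ≥ 2, i ∈ [N], p ∈ [d_x], and suppose L < log₃(d_x). Then for all weight configurations Θ but a set of Lebesgue measure zero in parameter space, the separation rank of y_p^{i,L,d_x,H,Θ} with respect to any balanced partition (A,B) satisfies 3^{L−2}·(log₃(d_x − H) − L + 2 − log₃ 2) ≤ log₃(sep(y_p^{i,L,d_x,H,Θ}; A, B)) ≤ ((3^L − 1)/2)·log₃(d_x + H). -/
open scoped BigOperators
open MeasureTheory Matrix

set_option synthInstance.maxSize 4000

/-- Continuous functions whose restriction to every line is a polynomial. -/
def PolyOnLines {E : Type*} [AddCommGroup E] [Module ℝ E] [TopologicalSpace E]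
    (f : E → ℝ) : Prop :=
  Continuous f ∧ ∀ a b : E, ∃ q : Polynomial ℝ, ∀ t : ℝ, f (a + t • b) = q.eval t

namespace PolyOnLines

section Algebra

variable {E : Type*} [AddCommGroup E] [Module ℝ E] [TopologicalSpace E] {f g : E → ℝ}

theorem const (c : ℝ) : PolyOnLines (fun _ : E => c) :=
  ⟨continuous_const, fun _ _ => ⟨Polynomial.C c, fun _ => by simp⟩⟩

theorem of_linear (φ : E →ₗ[ℝ] ℝ) (hφ : Continuous φ) : PolyOnLines (fun x => φ x) :=
  ⟨hφ, fun a b => ⟨Polynomial.C (φ a) + Polynomial.X * Polynomial.C (φ b), fun t => by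
    simp only [map_add, map_smul, smul_eq_mul, Polynomial.eval_add, Polynomial.eval_mul,
      Polynomial.eval_C, Polynomial.eval_X]⟩⟩

theorem add (hf : PolyOnLines f) (hg : PolyOnLines g) : PolyOnLines (fun x => f x + g x) := by
  refine ⟨hf.1.add hg.1, fun a b => ?_⟩
  obtain ⟨q, hq⟩ := hf.2 a b
  obtain ⟨r, hr⟩ := hg.2 a b
  exact ⟨q + r, fun t => by simp [hq, hr]⟩

theorem mul (hf : PolyOnLines f) (hg : PolyOnLines g) : PolyOnLines (fun x => f x * g x) := by
  refine ⟨hf.1.mul hg.1, fun a b => ?_⟩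
  obtain ⟨q, hq⟩ := hf.2 a b
  obtain ⟨r, hr⟩ := hg.2 a b
  exact ⟨q * r, fun t => by simp [hq, hr]⟩

theorem sum {ι : Type*} (s : Finset ι) {F : ι → E → ℝ} (h : ∀ i ∈ s, PolyOnLines (F i)) :
    PolyOnLines (fun x => ∑ i ∈ s, F i x) := by
  classical
  induction s using Finset.induction_on with
  | empty => simpa using const 0
  | insert a s ha ih =>
    simp only [Finset.sum_insert ha]
    exact (h a (by simp)).add (ih fun i hi => h i (by simp [hi]))

theorem prod {ι : Type*} (s : Finset ι) {F : ι → E → ℝ} (h : ∀ i ∈ s, PolyOnLines (F i)) :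
    PolyOnLines (fun x => ∏ i ∈ s, F i x) := by
  classical
  induction s using Finset.induction_on with
  | empty => simpa using const 1
  | insert a s ha ih =>
    simp only [Finset.prod_insert ha]
    exact (h a (by simp)).mul (ih fun i hi => h i (by simp [hi]))

theorem det {n : ℕ} {M : E → Matrix (Fin n) (Fin n) ℝ}
    (h : ∀ s t, PolyOnLines (fun x => M x s t)) : PolyOnLines (fun x => (M x).det) := by
  simp only [Matrix.det_apply']
  exact sum _ fun σ _ => (const _).mul (prod _ fun t _ => h _ _)

end Algebra

theorem ae_ne_zero {E : Type*} [NormedAddCommGroup E] [NormedSpace ℝ E] [FiniteDimensional ℝ E]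
    [MeasurableSpace E] [BorelSpace E] (μ : Measure E) [μ.IsAddHaarMeasure] {f : E → ℝ}
    (hf : PolyOnLines f) {a : E} (ha : f a ≠ 0) : ∀ᵐ x ∂μ, f x ≠ 0 := by
  have line : ∀ y : E, ∀ᵐ t : ℝ, f (a + t • y) ≠ 0 := by
    intro y
    obtain ⟨q, hq⟩ := hf.2 a y
    have hq0 : q ≠ 0 := by
      rintro rfl
      exact ha (by simpa using hq 0)
    rw [ae_iff]
    refine Set.Finite.measure_zero (q.roots.toFinset.finite_toSet.subset fun t ht => ?_) _
    have : f (a + t • y) = 0 := by simpa using ht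
    simpa [hq0, Polynomial.IsRoot, hq] using this
  have meas : MeasurableSet {z : E × ℝ | f (a + z.2 • z.1) ≠ 0} := by
    have hc : Continuous fun z : E × ℝ => f (a + z.2 • z.1) := hf.1.comp (by fun_prop)
    exact (isOpen_ne_fun hc continuous_const).measurableSet
  have swap : ∀ᵐ t : ℝ, ∀ᵐ y ∂μ, f (a + t • y) ≠ 0 :=
    (Measure.ae_ae_comm (μ := μ) (ν := (volume : Measure ℝ))
      (p := fun y t => f (a + t • y) ≠ 0) meas).1 (Filter.Eventually.of_forall line)
  have hne : ∀ᵐ t : ℝ, t ≠ 0 := by simp [ae_iff]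
  obtain ⟨t, ht, ht0⟩ := (swap.and hne).exists
  rw [ae_iff] at ht ⊢
  have h1 : {y : E | ¬ f (a + t • y) ≠ 0} =
      (fun y => t • y) ⁻¹' ((fun y => a + y) ⁻¹' {x | ¬ f x ≠ 0}) := rfl
  rw [h1, Measure.addHaar_preimage_smul μ ht0, measure_preimage_add] at ht
  have h2 : ENNReal.ofReal |(t ^ Module.finrank ℝ E)⁻¹| ≠ 0 := by
    simp [ht0]
  exact (mul_eq_zero.1 ht).resolve_left h2

end PolyOnLines

theorem polyOnLines_saNetAux {L H da dx N : ℕ} (x : Fin N → Fin dx → ℝ) (l : ℕ) (i : Fin N)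
    (p : Fin dx) :
    PolyOnLines (fun Θ : SAWeights L H da dx => saNetAux (extendW Θ) l x i p) := by
  induction l generalizing i p with
  | zero => exact PolyOnLines.const _
  | succ l ih =>
    simp only [saNetAux, saLayer, Finset.sum_apply, Pi.smul_apply, smul_eq_mul, Matrix.mulVec,
      dotProduct, Matrix.of_apply]
    by_cases hl : l < L
    · simp only [extendW, hl, dif_pos] at ih ⊢
      have coord (φ : SAWeights L H da dx →ₗ[ℝ] ℝ) : PolyOnLines (fun Θ => φ Θ) :=
        PolyOnLines.of_linear φ φ.continuous_of_finiteDimensional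
      let π (h : Fin H) : SAWeights L H da dx →ₗ[ℝ] HeadWeights da dx :=
        (LinearMap.proj h : (Fin H → HeadWeights da dx) →ₗ[ℝ] HeadWeights da dx).comp
          (LinearMap.proj ⟨l, hl⟩ : SAWeights L H da dx →ₗ[ℝ] Fin H → HeadWeights da dx)
      have hK (h : Fin H) (a : Fin da) (q : Fin dx) :
          PolyOnLines (fun Θ : SAWeights L H da dx => (Θ ⟨l, hl⟩ h).1 a q) :=
        coord ((LinearMap.proj q).comp ((LinearMap.proj a).comp
          ((LinearMap.fst ℝ _ _).comp (π h))))
      have hQ (h : Fin H) (a : Fin da) (q : Fin dx) :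
          PolyOnLines (fun Θ : SAWeights L H da dx => (Θ ⟨l, hl⟩ h).2.1 a q) :=
        coord ((LinearMap.proj q).comp ((LinearMap.proj a).comp
          ((LinearMap.fst ℝ _ _).comp ((LinearMap.snd ℝ _ _).comp (π h)))))
      have hV (h : Fin H) (a : Fin da) (q : Fin dx) :
          PolyOnLines (fun Θ : SAWeights L H da dx => (Θ ⟨l, hl⟩ h).2.2.1 a q) :=
        coord ((LinearMap.proj q).comp ((LinearMap.proj a).comp
          ((LinearMap.fst ℝ _ _).comp ((LinearMap.snd ℝ _ _).comp
            ((LinearMap.snd ℝ _ _).comp (π h))))))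
      have hO (h : Fin H) (a : Fin da) (q : Fin dx) :
          PolyOnLines (fun Θ : SAWeights L H da dx => (Θ ⟨l, hl⟩ h).2.2.2 q a) :=
        coord ((LinearMap.proj a).comp ((LinearMap.proj q).comp
          ((LinearMap.snd ℝ _ _).comp ((LinearMap.snd ℝ _ _).comp
            ((LinearMap.snd ℝ _ _).comp (π h))))))
      refine .sum _ fun j _ => .sum _ fun h _ => .mul (.sum _ fun a _ => .mul ?_ ?_)
        (.sum _ fun a _ => .mul (hO _ _ _) ?_)
      · exact .sum _ fun q _ => (hQ _ _ _).mul (ih _ _)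
      · exact .sum _ fun q _ => (hK _ _ _).mul (ih _ _)
      · exact .sum _ fun q _ => (hV _ _ _).mul (ih _ _)
    · simpa [extendW, hl] using PolyOnLines.const 0

instance isAddHaarMeasure_volume_headWeights (da dx : ℕ) :
    (volume : Measure (HeadWeights da dx)).IsAddHaarMeasure := by
  have h (m n : ℕ) : (volume : Measure (Fin m → Fin n → ℝ)).IsAddHaarMeasure :=
    inferInstance
  have h₁ : (volume : Measure ((Fin da → Fin dx → ℝ) × (Fin dx → Fin da → ℝ))).IsAddHaarMeasure :=
    Measure.prod.instIsAddHaarMeasure _ _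
  have h₂ : (volume : Measure ((Fin da → Fin dx → ℝ) × (Fin da → Fin dx → ℝ) ×
      (Fin dx → Fin da → ℝ))).IsAddHaarMeasure :=
    Measure.prod.instIsAddHaarMeasure _ _
  exact Measure.prod.instIsAddHaarMeasure _ _

instance isAddHaarMeasure_volume_saWeights (L H da dx : ℕ) :
    (volume : Measure (SAWeights L H da dx)).IsAddHaarMeasure := by
  have : (volume : Measure (Fin H → HeadWeights da dx)).IsAddHaarMeasure := inferInstance
  infer_instance

/-- `f` is a sum of `n` products of a function of the inputs in `A` with one of those in `B`. -/
def HasSep {N dx : ℕ} (f : (Fin N → Fin dx → ℝ) → ℝ) (A B : Finset (Fin N)) (n : ℕ) : Prop :=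
  ∃ g g' : Fin n → ((Fin N → Fin dx → ℝ) → ℝ),
    (∀ r, DependsOnlyOn (g r) A) ∧ (∀ r, DependsOnlyOn (g' r) B) ∧
    ∀ x, f x = ∑ r : Fin n, g r x * g' r x

namespace HasSep

variable {N dx : ℕ} {f f' : (Fin N → Fin dx → ℝ) → ℝ} {A B : Finset (Fin N)} {m n : ℕ}

theorem symm (h : HasSep f A B n) : HasSep f B A n := by
  obtain ⟨g, g', hg, hg', hf⟩ := h
  exact ⟨g', g, hg', hg, fun x => by simp only [hf x, mul_comm]⟩

theorem of_dependsOnlyOn (h : DependsOnlyOn f A) : HasSep f A B 1 :=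
  ⟨fun _ => f, fun _ _ => 1, fun _ => h, fun _ _ _ _ => rfl, fun x => by simp⟩

theorem add (h : HasSep f A B n) (h' : HasSep f' A B m) :
    HasSep (fun x => f x + f' x) A B (n + m) := by
  obtain ⟨g, k, hg, hk, hf⟩ := h
  obtain ⟨g', k', hg', hk', hf'⟩ := h'
  refine ⟨Fin.append g g', Fin.append k k', fun r => ?_, fun r => ?_, fun x => ?_⟩
  · induction r using Fin.addCases <;> simp [hg, hg']
  · induction r using Fin.addCases <;> simp [hk, hk']
  · simp [Fin.sum_univ_add, hf x, hf' x]

theorem mul_left (h : HasSep f A B n) (h' : DependsOnlyOn f' A) :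
    HasSep (fun x => f' x * f x) A B n := by
  obtain ⟨g, k, hg, hk, hf⟩ := h
  refine ⟨fun r x => f' x * g r x, k, fun r x y hxy => ?_, hk, fun x => ?_⟩
  · simp only [hg r x y hxy, h' x y hxy]
  · simp only [hf x, Finset.mul_sum, mul_assoc]

theorem sum {ι : Type*} (s : Finset ι) {F : ι → (Fin N → Fin dx → ℝ) → ℝ}
    (h : ∀ i ∈ s, HasSep (F i) A B n) : HasSep (fun x => ∑ i ∈ s, F i x) A B (s.card * n) := by
  classical
  induction s using Finset.induction_on with
  | empty =>
    exact ⟨fun _ _ => 0, fun _ _ => 0, fun _ _ _ _ => rfl, fun _ _ _ _ => rfl, by simp⟩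
  | insert a s ha ih =>
    simp only [Finset.sum_insert ha, Finset.card_insert_of_notMem ha]
    rw [add_mul, one_mul, add_comm]
    exact (h a (by simp)).add (ih fun i hi => h i (by simp [hi]))

/-- A nonsingular grid of values bounds the number of summands from below. -/
theorem le_of_det_ne_zero (h : HasSep f A B n) {X Y : Fin m → Fin N → Fin dx → ℝ}
    (hX : ∀ s, ∀ j ∈ B, X s j = 0) (hY : ∀ t, ∀ j ∈ A, Y t j = 0)
    (hdet : (Matrix.of fun s t => f (X s + Y t)).det ≠ 0) : m ≤ n := by
  obtain ⟨g, g', hg, hg', hf⟩ := h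
  have hfac : (Matrix.of fun s t => f (X s + Y t)) =
      (Matrix.of fun s r => g r (X s)) * (Matrix.of fun r t => g' r (Y t)) := by
    ext s t
    simp only [Matrix.of_apply, Matrix.mul_apply, hf]
    refine Finset.sum_congr rfl fun r _ => ?_
    rw [hg r (X s + Y t) (X s) fun j hj => by simp [hY t j hj],
      hg' r (X s + Y t) (Y t) fun j hj => by simp [hX s j hj]]
  have h1 := Matrix.rank_of_isUnit _ ((Matrix.isUnit_iff_isUnit_det _).2 hdet.isUnit)
  rw [hfac] at h1
  have h2 := (Matrix.rank_mul_le_left (Matrix.of fun s r => g r (X s))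
    (Matrix.of fun r t => g' r (Y t))).trans (Matrix.rank_le_width _)
  simpa [h1] using h2

theorem exists_sepRank_eq (h : HasSep f A B n) :
    ∃ k : ℕ, sepRank f A B = k ∧ k ≤ n ∧ HasSep f A B k := by
  obtain ⟨k, hk, hsep⟩ : sepRank f A B ∈ {R : ℕ∞ | ∃ n : ℕ, R = (n : ℕ∞) ∧ HasSep f A B n} :=
    csInf_mem (s := {R : ℕ∞ | ∃ n : ℕ, R = (n : ℕ∞) ∧ HasSep f A B n}) ⟨n, n, rfl, h⟩
  refine ⟨k, hk, ?_, hsep⟩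
  have : sepRank f A B ≤ n := sInf_le ⟨n, rfl, h⟩
  rw [hk] at this
  exact_mod_cast this

end HasSep

/-- Matrix words `W₀ G W₁ G ⋯ G W_c` in which `W₁, …, W_c` factor through dimension `da`. -/
inductive BondWord (da : ℕ) {dx : ℕ} :
    ℕ → (Matrix (Fin dx) (Fin dx) ℝ → Matrix (Fin dx) (Fin dx) ℝ) → Prop
  | const (W : Matrix (Fin dx) (Fin dx) ℝ) : BondWord da 0 (fun _ => W)
  | snoc {c : ℕ} {F : Matrix (Fin dx) (Fin dx) ℝ → Matrix (Fin dx) (Fin dx) ℝ}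
      (S : Matrix (Fin dx) (Fin da) ℝ) (R : Matrix (Fin da) (Fin dx) ℝ) (hF : BondWord da c F) :
      BondWord da (c + 1) (fun G => F G * G * (S * R))

namespace BondWord

variable {da dx c c' c'' : ℕ}
  {F F' F'' : Matrix (Fin dx) (Fin dx) ℝ → Matrix (Fin dx) (Fin dx) ℝ}

theorem mul_left (M : Matrix (Fin dx) (Fin dx) ℝ) (hF : BondWord da c F) :
    BondWord da c (fun G => M * F G) := by
  induction hF with
  | const W => exact .const _
  | snoc S R hF ih => simpa only [Matrix.mul_assoc] using ih.snoc S R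

theorem append (hF : BondWord da c F) (S : Matrix (Fin dx) (Fin da) ℝ)
    (R : Matrix (Fin da) (Fin dx) ℝ) (hF' : BondWord da c' F') :
    BondWord da (c + 1 + c') (fun G => F G * G * (S * R) * F' G) := by
  induction hF' with
  | const W => simpa only [Matrix.mul_assoc, add_zero] using hF.snoc S (R * W)
  | snoc S' R' hF' ih => simpa only [Matrix.mul_assoc, add_assoc] using ih.snoc S' R'

theorem append_transpose (hF : BondWord da c F) (hF' : BondWord da c' F')
    (S : Matrix (Fin dx) (Fin da) ℝ) (R : Matrix (Fin da) (Fin dx) ℝ) (hF'' : BondWord da c'' F'') :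
    BondWord da (c + 1 + c' + c'')
      (fun G => F G * G * (F' Gᵀ)ᵀ * (S * R) * F'' G) := by
  induction hF' generalizing c F with
  | const W => simpa only [Matrix.mul_assoc, add_zero] using hF.append (Wᵀ * S) R hF''
  | @snoc k F₁ S' R' hF' ih =>
    have h := ih (hF.snoc R'ᵀ S'ᵀ)
    have e : c + 1 + (k + 1) + c'' = c + 1 + 1 + k + c'' := by ring
    rw [e]
    simpa only [Matrix.mul_assoc, Matrix.transpose_mul, Matrix.transpose_transpose] using h

end BondWord

/-- The Gram sum `Σ_{j ∈ S} x^j (x^j)ᵀ`. -/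
def gramSum {N dx : ℕ} (S : Finset (Fin N)) (x : Fin N → Fin dx → ℝ) :
    Matrix (Fin dx) (Fin dx) ℝ := ∑ j ∈ S, Matrix.vecMulVec (x j) (x j)

theorem gramSum_transpose {N dx : ℕ} (S : Finset (Fin N)) (x : Fin N → Fin dx → ℝ) :
    (gramSum S x)ᵀ = gramSum S x := by
  simp [gramSum, Matrix.transpose_sum, Matrix.transpose_vecMulVec]

theorem gramSum_congr {N dx : ℕ} {S : Finset (Fin N)} {x y : Fin N → Fin dx → ℝ}
    (h : ∀ j ∈ S, x j = y j) : gramSum S x = gramSum S y :=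
  Finset.sum_congr rfl fun j hj => by rw [h j hj]

theorem BondWord.hasSep {N da dx c : ℕ}
    {F : Matrix (Fin dx) (Fin dx) ℝ → Matrix (Fin dx) (Fin dx) ℝ} (hF : BondWord da c F)
    (p : Fin dx) {A B : Finset (Fin N)} (hAB : Disjoint A B) (hU : A ∪ B = Finset.univ)
    {v : (Fin N → Fin dx → ℝ) → Fin dx → ℝ}
    (hv : ∀ x y, (∀ j ∈ A, x j = y j) → v x = v y) :
    HasSep (fun x => (F (gramSum Finset.univ x) *ᵥ v x) p) A B ((1 + da) ^ c) := by
  induction hF generalizing A B v with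
  | const W =>
    rw [pow_zero]
    exact .of_dependsOnlyOn fun x y h => by simp only [hv x y h]
  | @snoc c F S R hF ih =>
    have hG (x : Fin N → Fin dx → ℝ) : gramSum Finset.univ x = gramSum A x + gramSum B x := by
      rw [gramSum, ← hU, Finset.sum_union hAB, gramSum, gramSum]
    have hA := ih hAB hU (v := fun x => gramSum A x *ᵥ ((S * R) *ᵥ v x))
      fun x y h => by simp only [gramSum_congr h, hv x y h]
    have hB (a : Fin da) := ((ih (A := B) (B := A) hAB.symm (by rw [Finset.union_comm, hU])
      (v := fun x => gramSum B x *ᵥ (fun q => S q a))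
      fun x y h => by simp only [gramSum_congr h]).symm).mul_left
      (f' := fun x => (R *ᵥ v x) a) fun x y h => by simp only [hv x y h]
    have hsum := hA.add (HasSep.sum Finset.univ fun a _ => hB a)
    rw [Finset.card_univ, Fintype.card_fin, ← one_add_mul, ← pow_succ'] at hsum
    convert hsum using 2 with x
    have hS : S *ᵥ (R *ᵥ v x) = ∑ a, (R *ᵥ v x) a • (fun q => S q a) := by
      ext q
      simp [Matrix.mulVec, dotProduct, mul_comm]
    have hcol : (F (gramSum Finset.univ x) *ᵥ (gramSum B x *ᵥ (S *ᵥ (R *ᵥ v x)))) p =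
        ∑ a, (R *ᵥ v x) a *
          (F (gramSum Finset.univ x) *ᵥ (gramSum B x *ᵥ fun q => S q a)) p := by
      rw [hS]
      simp [Matrix.mulVec_sum, Matrix.mulVec_smul, Finset.sum_apply]
    rw [← hcol, ← Matrix.mulVec_mulVec, ← Matrix.mulVec_mulVec, ← Matrix.mulVec_mulVec,
      ← Pi.add_apply, ← Matrix.mulVec_add, ← Matrix.add_mulVec, ← hG]

/-- The matrix `P_l(G)` through which the depth-`l` network acts: `x^{l+1,i} = P_l(G) x^i`. -/
noncomputable def netMatrix {H da dx : ℕ} (W : ℕ → Fin H → HeadWeights da dx) :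
    ℕ → Matrix (Fin dx) (Fin dx) ℝ → Matrix (Fin dx) (Fin dx) ℝ
  | 0, _ => 1
  | (l + 1), G => ∑ h : Fin H, (Matrix.of (W l h).2.2.2 * Matrix.of (W l h).2.2.1) *
      (netMatrix W l G * G * (netMatrix W l Gᵀ)ᵀ *
        ((Matrix.of (W l h).1)ᵀ * Matrix.of (W l h).2.1) * netMatrix W l G)

theorem saNetAux_eq_netMatrix {N H da dx : ℕ} (W : ℕ → Fin H → HeadWeights da dx) (l : ℕ)
    (x : Fin N → Fin dx → ℝ) (i : Fin N) :
    saNetAux W l x i = netMatrix W l (gramSum Finset.univ x) *ᵥ x i := by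
  induction l generalizing i with
  | zero => simp [saNetAux, netMatrix]
  | succ l ih =>
    simp only [saNetAux, saLayer, netMatrix, gramSum_transpose]
    rw [Matrix.sum_mulVec, Finset.sum_comm]
    refine Finset.sum_congr rfl fun h _ => ?_
    simp only [ih]
    set P := netMatrix W l (gramSum Finset.univ x)
    set K := Matrix.of (W l h).1
    set Q := Matrix.of (W l h).2.1
    simp only [← Matrix.mulVec_mulVec]
    have hG (u : Fin dx → ℝ) : gramSum Finset.univ x *ᵥ u = ∑ j, (u ⬝ᵥ x j) • x j := by
      simp [gramSum, Matrix.sum_mulVec, Matrix.vecMulVec_mulVec, dotProduct_comm]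
    rw [hG]
    simp only [Matrix.mulVec_sum, Matrix.mulVec_smul]
    refine Finset.sum_congr rfl fun j _ => ?_
    congr 1
    change (Q *ᵥ (P *ᵥ x i)) ⬝ᵥ (K *ᵥ (P *ᵥ x j)) = _
    rw [Matrix.mulVec_transpose, Matrix.mulVec_transpose, ← Matrix.dotProduct_mulVec,
      ← Matrix.dotProduct_mulVec]

/-- The number `(3^l - 1) / 2` of Gram factors in a word of the depth-`l` network. -/
def wordLength : ℕ → ℕ
  | 0 => 0
  | l + 1 => 3 * wordLength l + 1

theorem two_mul_wordLength_add_one (l : ℕ) : 2 * wordLength l + 1 = 3 ^ l := by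
  induction l with
  | zero => rfl
  | succ l ih => rw [pow_succ, ← ih, wordLength]; ring

theorem netMatrix_eq_sum_bondWord {H da dx : ℕ} (W : ℕ → Fin H → HeadWeights da dx) (l : ℕ) :
    ∃ (ι : Type) (_ : Fintype ι)
      (F : ι → Matrix (Fin dx) (Fin dx) ℝ → Matrix (Fin dx) (Fin dx) ℝ),
      Fintype.card ι = H ^ wordLength l ∧ (∀ w, BondWord da (wordLength l) (F w)) ∧
      ∀ G, netMatrix W l G = ∑ w, F w G := by
  induction l with
  | zero =>
    exact ⟨Unit, inferInstance, fun _ _ => 1, by simp [wordLength], fun _ => .const _,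
      fun G => by simp [netMatrix]⟩
  | succ l ih =>
    obtain ⟨ι, _, F, hcard, hF, hsum⟩ := ih
    refine ⟨Fin H × ι × ι × ι, inferInstance, fun w G =>
      (Matrix.of (W l w.1).2.2.2 * Matrix.of (W l w.1).2.2.1) *
        (F w.2.2.2 G * G * (F w.2.2.1 Gᵀ)ᵀ *
          ((Matrix.of (W l w.1).1)ᵀ * Matrix.of (W l w.1).2.1) * F w.2.1 G), ?_, ?_, ?_⟩
    · simp only [Fintype.card_prod, Fintype.card_fin, hcard, wordLength]
      ring
    · intro w
      have h := ((hF w.2.2.2).append_transpose (hF w.2.2.1) (Matrix.of (W l w.1).1)ᵀ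
        (Matrix.of (W l w.1).2.1) (hF w.2.1)).mul_left
        (Matrix.of (W l w.1).2.2.2 * Matrix.of (W l w.1).2.2.1)
      have e : wordLength (l + 1) = wordLength l + 1 + wordLength l + wordLength l := by
        rw [wordLength]; ring
      rw [e]
      exact h
    · intro G
      simp only [netMatrix, hsum, Matrix.transpose_sum, Fintype.sum_prod_type, Matrix.sum_mul,
        Matrix.mul_sum]


theorem hasSep_saOutput {L H da dx N : ℕ} (Θ : SAWeights L H da dx) (i : Fin N) (p : Fin dx)
    {A B : Finset (Fin N)} (hAB : Disjoint A B) (hU : A ∪ B = Finset.univ) :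
    HasSep (saOutput L N Θ i p) A B ((H * da + H) ^ wordLength L) := by
  wlog hi : i ∈ A generalizing A B with key
  · refine (key hAB.symm (by rw [Finset.union_comm, hU]) ?_).symm
    have : i ∈ A ∪ B := by simp [hU]
    exact (Finset.mem_union.1 this).resolve_left hi
  obtain ⟨ι, _, F, hcard, hF, hsum⟩ := netMatrix_eq_sum_bondWord (extendW Θ) L
  have h := HasSep.sum Finset.univ fun w _ =>
    (hF w).hasSep p hAB hU (v := fun x : Fin N → Fin dx → ℝ => x i) fun x y hxy => hxy i hi
  rw [Finset.card_univ, hcard, ← mul_pow, mul_one_add, add_comm] at h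
  convert h using 2 with x
  rw [saOutput, saNetAux_eq_netMatrix, hsum, Matrix.sum_mulVec, Finset.sum_apply]

/-- Powers of a sparse exponential sum give a nonsingular grid whose size is the number of
distinct `K`-fold sums of exponents. -/
theorem det_pow_sum_ne_zero {d : ℕ} (K : ℕ) (w : Fin d → ℕ) (n : ℕ)
    (hn : (Finset.univ.image fun α : Fin K → Fin d => ∑ k, w (α k)).card = n) :
    (Matrix.of fun s t : Fin n =>
      (∑ r, ((2 : ℝ) ^ w r) ^ (s : ℕ) * ((2 : ℝ) ^ w r) ^ (t : ℕ)) ^ K).det ≠ 0 := by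
  classical
  set E := Finset.univ.image fun α : Fin K → Fin d => ∑ k, w (α k) with hE
  let ε : Fin n ≃ E := (E.equivFinOfCardEq hn).symm
  let c (e : ℕ) : ℝ := ((Finset.univ.filter fun α : Fin K → Fin d => ∑ k, w (α k) = e).card : ℝ)
  let V : Matrix (Fin n) (Fin n) ℝ := Matrix.vandermonde fun r => (2 : ℝ) ^ (ε r : ℕ)
  have hfac : (Matrix.of fun s t : Fin n =>
      (∑ r, ((2 : ℝ) ^ w r) ^ (s : ℕ) * ((2 : ℝ) ^ w r) ^ (t : ℕ)) ^ K) =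
      Vᵀ * Matrix.diagonal (fun r => c (ε r)) * V := by
    ext s t
    have h1 : (∑ r, ((2 : ℝ) ^ w r) ^ (s : ℕ) * ((2 : ℝ) ^ w r) ^ (t : ℕ)) ^ K =
        ∑ α : Fin K → Fin d, (fun e : ℕ => ((2 : ℝ) ^ e) ^ (s : ℕ) * ((2 : ℝ) ^ e) ^ (t : ℕ))
          (∑ k, w (α k)) := by
      rw [Finset.sum_pow', Fintype.piFinset_univ]
      refine Finset.sum_congr rfl fun α _ => ?_
      simp only [← Finset.prod_pow_eq_pow_sum, Finset.prod_mul_distrib, Finset.prod_pow]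
    rw [Matrix.of_apply, h1]
    refine (Finset.sum_comp (fun e : ℕ => ((2 : ℝ) ^ e) ^ (s : ℕ) * ((2 : ℝ) ^ e) ^ (t : ℕ))
      fun α : Fin K → Fin d => ∑ k, w (α k)).trans ?_
    rw [← hE, ← Finset.sum_coe_sort E, ← ε.sum_comp, Matrix.mul_apply]
    refine Finset.sum_congr rfl fun r _ => ?_
    simp only [Matrix.mul_diagonal, Matrix.transpose_apply, V, Matrix.vandermonde_apply, c,
      nsmul_eq_mul]
    ring
  have hV : V.det ≠ 0 := by
    rw [Matrix.det_vandermonde_ne_zero_iff]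
    intro r r' h
    have := pow_right_injective₀ (two_pos : (0 : ℝ) < 2) (by norm_num) h
    exact ε.injective (Subtype.ext this)
  rw [hfac, Matrix.det_mul, Matrix.det_mul, Matrix.det_transpose, Matrix.det_diagonal]
  refine mul_ne_zero (mul_ne_zero hV (Finset.prod_ne_zero_iff.2 fun r _ => ?_)) hV
  obtain ⟨α, -, hα⟩ := Finset.mem_image.1 (ε r).2
  have hpos : 0 < (Finset.univ.filter fun β : Fin K → Fin d => ∑ k, w (β k) = ε r).card :=
    Finset.card_pos.2 ⟨α, by simpa using hα⟩
  exact Nat.cast_ne_zero.2 (ne_of_gt hpos)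

/-- The exponents `0` and `j * g ^ k` for `1 ≤ j`, `k < K`. -/
def digitWeight (g K : ℕ) : ℕ → ℕ
  | 0 => 0
  | r + 1 => (r / K + 1) * g ^ (r % K)

theorem pow_le_card_digit_sums {g K d : ℕ} (hd : K * g + 1 ≤ d) :
    (g + 1) ^ K ≤
      (Finset.univ.image fun α : Fin K → Fin d => ∑ k, digitWeight (g + 1) K (α k)).card := by
  classical
  rw [← Finset.card_range ((g + 1) ^ K)]
  refine Finset.card_le_card fun e he => ?_
  obtain ⟨f, hf⟩ := finFunctionFinEquiv.surjective (⟨e, Finset.mem_range.1 he⟩ : Fin ((g + 1) ^ K))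
  have hfe : ∑ k, (f k : ℕ) * (g + 1) ^ (k : ℕ) = e := by
    rw [← finFunctionFinEquiv_apply, hf]
  have hdig (k : Fin K) : ∃ r : Fin d, digitWeight (g + 1) K r = (f k : ℕ) * (g + 1) ^ (k : ℕ) := by
    rcases hj : (f k : ℕ) with _ | j
    · exact ⟨⟨0, by lia⟩, by simp [digitWeight]⟩
    · have hjg : j < g := by have := (f k).2; lia
      have hlt : K * j + k < K * g := by
        have : K * (j + 1) ≤ K * g := Nat.mul_le_mul_left _ hjg
        have := k.2
        lia
      refine ⟨⟨K * j + k + 1, by lia⟩, ?_⟩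
      have hK : 0 < K := k.pos
      simp only [digitWeight]
      rw [Nat.mul_add_div hK, Nat.div_eq_of_lt k.2, Nat.mul_add_mod, Nat.mod_eq_of_lt k.2, add_zero]
  choose α hα using hdig
  exact Finset.mem_image.2 ⟨α, Finset.mem_univ _, by simp only [hα, hfe]⟩

/-- A head reading coordinate `c` as its value, and copying it with weight `o` to all coordinates. -/
noncomputable def readHead {da dx : ℕ} (K Q : Fin da → Fin dx → ℝ) (a₀ : Fin da) (c : Fin dx)
    (o : ℝ) : HeadWeights da dx :=
  (K, Q, fun a => if a = a₀ then Pi.single c 1 else 0, fun _ a => if a = a₀ then o else 0)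

theorem saLayer_readHead {N H da dx : ℕ} (K Q : Fin H → Fin da → Fin dx → ℝ) (a₀ : Fin da)
    (c : Fin dx) (o : ℝ) (x : Fin N → Fin dx → ℝ) (i : Fin N) (q : Fin dx) :
    saLayer (fun h => readHead (K h) (Q h) a₀ c o) x i q =
      ∑ j, (∑ h, ∑ a, (Q h a ⬝ᵥ x i) * (K h a ⬝ᵥ x j)) * (o * x j c) := by
  simp only [saLayer, Finset.sum_apply, Pi.smul_apply, smul_eq_mul, readHead, Finset.sum_mul]
  refine Finset.sum_congr rfl fun j _ => Finset.sum_congr rfl fun h _ => ?_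
  have hval : ((Matrix.of fun (_ : Fin dx) (a : Fin da) => if a = a₀ then o else 0) *ᵥ
      ((Matrix.of fun a : Fin da => if a = a₀ then Pi.single c (1 : ℝ) else 0) *ᵥ x j)) q =
      o * x j c := by
    simp [Matrix.mulVec, dotProduct, ite_mul, Pi.single_apply]
  rw [hval]
  rfl

/-- Weights for which the network computes `⟨u, v⟩ ^ 3 ^ l` at depth `l + 1`, where `u` occupies the first `d`
coordinates of one input, `v` the next `d` coordinates of another, and coordinate `2 d` of the
latter is `1`. -/
noncomputable def powerWeights (H da d : ℕ) (a₀ : Fin da) (hd : 2 * d + 1 ≤ H * da) :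
    ℕ → Fin H → HeadWeights da (H * da)
  | 0 => fun h => readHead
      (fun a => if hs : (finProdFinEquiv (h, a) : ℕ) < d then
        Pi.single ⟨d + finProdFinEquiv (h, a), by lia⟩ 1 else 0)
      (fun a => if (finProdFinEquiv (h, a) : ℕ) < d then Pi.single (finProdFinEquiv (h, a)) 1 else 0)
      a₀ ⟨2 * d, by lia⟩ 1
  | _ + 1 => fun _ => readHead
      (fun a => if a = a₀ then Pi.single ⟨2 * d, by lia⟩ 1 else 0)
      (fun a => if a = a₀ then Pi.single ⟨2 * d, by lia⟩ 1 else 0)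
      a₀ ⟨2 * d, by lia⟩ (H : ℝ)⁻¹

/-- The vector with `u` in the first `d` coordinates. -/
def queryVec {d : ℕ} (n : ℕ) (u : Fin d → ℝ) : Fin n → ℝ := fun q =>
  if h : (q : ℕ) < d then u ⟨q, h⟩ else 0

/-- The vector with `v` in coordinates `d, …, 2 d - 1` and `1` in coordinate `2 d`. -/
def keyVec {d : ℕ} (n : ℕ) (v : Fin d → ℝ) : Fin n → ℝ := fun q =>
  if h : d ≤ (q : ℕ) ∧ (q : ℕ) < 2 * d then v ⟨q - d, by lia⟩ else if (q : ℕ) = 2 * d then 1 else 0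

theorem saNetAux_powerWeights {N H da d : ℕ} (a₀ : Fin da) (hd : 2 * d + 1 ≤ H * da)
    {i j : Fin N} (hij : i ≠ j) (u v : Fin d → ℝ) (l : ℕ) :
    saNetAux (powerWeights H da d a₀ hd) (l + 1)
      (Pi.single i (queryVec (H * da) u) + Pi.single j (keyVec (H * da) v)) =
      Pi.single i (fun _ => (∑ r, u r * v r) ^ 3 ^ l) := by
  have hH : (H : ℝ) ≠ 0 := by
    rintro h
    have : H = 0 := by exact_mod_cast h
    subst this
    lia
  induction l with
  | zero =>
    set x : Fin N → Fin (H * da) → ℝ :=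
      Pi.single i (queryVec (H * da) u) + Pi.single j (keyVec (H * da) v) with hx
    have hxi : x i = queryVec (H * da) u := by simp [hx, hij]
    have hxj : x j = keyVec (H * da) v := by simp [hx, hij.symm]
    have hxk (k : Fin N) (hki : k ≠ i) (hkj : k ≠ j) : x k = 0 := by simp [hx, hki, hkj]
    have hval (k : Fin N) (hkj : k ≠ j) : x k ⟨2 * d, by lia⟩ = 0 := by
      rcases eq_or_ne k i with rfl | hki
      · simp [hxi, queryVec]; lia
      · simp [hxk k hki hkj]
    funext k q
    simp only [saNetAux, powerWeights]
    rw [saLayer_readHead, Finset.sum_eq_single j (fun b _ hb => by simp [hval b hb]) (by simp)]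
    have hvj : x j ⟨2 * d, by lia⟩ = 1 := by simp [hxj, keyVec]
    rw [hvj, mul_one, mul_one]
    have hscore : ∀ y : Fin (H * da) → ℝ, (∑ h : Fin H, ∑ a : Fin da,
        ((if (finProdFinEquiv (h, a) : ℕ) < d then Pi.single (finProdFinEquiv (h, a)) (1 : ℝ)
          else 0) ⬝ᵥ y) *
        ((if hs : (finProdFinEquiv (h, a) : ℕ) < d then
          Pi.single (⟨d + finProdFinEquiv (h, a), by lia⟩ : Fin (H * da)) (1 : ℝ) else 0) ⬝ᵥ x j)) =
        ∑ r : Fin d, y ⟨r, by lia⟩ * v r := by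
      intro y
      let Φ (s : Fin (H * da)) : ℝ :=
        ((if (s : ℕ) < d then Pi.single s (1 : ℝ) else 0) ⬝ᵥ y) *
          ((if hs : (s : ℕ) < d then
            Pi.single (⟨d + s, by lia⟩ : Fin (H * da)) (1 : ℝ) else 0) ⬝ᵥ x j)
      have hΦ : ∑ h : Fin H, ∑ a : Fin da, Φ (finProdFinEquiv (h, a)) = ∑ s, Φ s := by
        rw [← finProdFinEquiv.sum_comp, Fintype.sum_prod_type]
      refine hΦ.trans (Finset.sum_of_injOn (fun r : Fin d => (⟨r, by lia⟩ : Fin (H * da)))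
        (fun r _ r' _ h => Fin.ext (by simpa using h)) (by simp) ?_ ?_).symm
      · intro s _ hs
        have : ¬ (s : ℕ) < d := fun h => hs ⟨⟨s, h⟩, by simp, rfl⟩
        simp [Φ, this]
      · intro r _
        have hr := r.2
        have h1 : d + (r : ℕ) < 2 * d := by lia
        simp [Φ, hxj, keyVec, h1]
    rw [hscore]
    rcases eq_or_ne k i with rfl | hki
    · simp [hxi, queryVec]
    · rw [Pi.single_eq_of_ne hki]
      refine Finset.sum_eq_zero fun r _ => ?_
      rcases eq_or_ne k j with rfl | hkj
      · have hr := r.2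
        have h1 : ¬ (d ≤ (r : ℕ)) := by lia
        have h2 : (r : ℕ) ≠ 2 * d := by lia
        simp [hxj, keyVec, h1, h2]
      · simp [hxk k hki hkj]
  | succ l ih =>
    rw [saNetAux, ih]
    set α := (∑ r, u r * v r) ^ 3 ^ l with hα
    have hpow : (∑ r, u r * v r) ^ 3 ^ (l + 1) = α ^ 3 := by rw [hα, ← pow_mul, pow_succ]
    rw [hpow]
    funext k q
    simp only [powerWeights]
    rw [saLayer_readHead, Finset.sum_eq_single i (fun b _ hb => by simp [hb]) (by simp)]
    rcases eq_or_ne k i with rfl | hki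
    · have hscore (y : Fin (H * da) → ℝ) (c : Fin (H * da)) :
          ∑ a, ((if a = a₀ then Pi.single c (1 : ℝ) else 0) ⬝ᵥ y) *
            ((if a = a₀ then Pi.single c (1 : ℝ) else 0) ⬝ᵥ y) = y c * y c := by
        rw [Finset.sum_eq_single a₀ (fun a _ ha => by simp [ha]) (by simp)]
        simp
      simp only [hscore, Pi.single_eq_same, Finset.sum_const, Finset.card_univ, Fintype.card_fin,
        nsmul_eq_mul]
      field_simp
    · simp [hki]

/-- For almost all weights, the separation rank is at least the number of distinct
`3 ^ (L - 1)`-fold sums of the given exponents. -/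
theorem ae_card_le_of_hasSep {L H da N d : ℕ} (hL : 1 ≤ L) (hd : 2 * d + 1 ≤ H * da) (i : Fin N)
    (p : Fin (H * da)) {A B : Finset (Fin N)} (hAB : Disjoint A B) (hi : i ∈ A)
    (hB : B.Nonempty) (w : Fin d → ℕ) :
    ∀ᵐ Θ : SAWeights L H da (H * da), ∀ n, HasSep (saOutput L N Θ i p) A B n →
      (Finset.univ.image fun α : Fin (3 ^ (L - 1)) → Fin d => ∑ k, w (α k)).card ≤ n := by
  obtain ⟨j, hj⟩ := hB
  have hij : i ≠ j := fun h => Finset.disjoint_left.1 hAB hi (h ▸ hj)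
  have hda : 0 < da := Nat.pos_of_ne_zero (by rintro rfl; lia)
  set m := (Finset.univ.image fun α : Fin (3 ^ (L - 1)) → Fin d => ∑ k, w (α k)).card with hm
  let U (s : Fin m) : Fin d → ℝ := fun r => ((2 : ℝ) ^ w r) ^ (s : ℕ)
  let X (s : Fin m) : Fin N → Fin (H * da) → ℝ := Pi.single i (queryVec (H * da) (U s))
  let Y (t : Fin m) : Fin N → Fin (H * da) → ℝ := Pi.single j (keyVec (H * da) (U t))
  have hpoly : PolyOnLines (fun Θ : SAWeights L H da (H * da) =>
      (Matrix.of fun s t => saOutput L N Θ i p (X s + Y t)).det) :=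
    .det fun s t => polyOnLines_saNetAux _ _ _ _
  let Θ₀ : SAWeights L H da (H * da) := fun l => powerWeights H da d ⟨0, hda⟩ hd l
  have hΘ₀ (l : ℕ) (hl : l ≤ L) (x : Fin N → Fin (H * da) → ℝ) :
      saNetAux (extendW Θ₀) l x = saNetAux (powerWeights H da d ⟨0, hda⟩ hd) l x := by
    induction l with
    | zero => rfl
    | succ l ih =>
      have hlL : l < L := hl
      simp only [saNetAux, ih hlL.le, extendW, hlL, dif_pos, Θ₀]
  have hne : (Matrix.of fun s t => saOutput L N Θ₀ i p (X s + Y t)).det ≠ 0 := by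
    convert det_pow_sum_ne_zero (3 ^ (L - 1)) w m hm.symm using 3
    funext s t
    obtain ⟨l, rfl⟩ : ∃ l, L = l + 1 := ⟨L - 1, by lia⟩
    simp only [saOutput, hΘ₀ _ le_rfl, X, Y]
    rw [saNetAux_powerWeights _ _ hij]
    simp [U]
  filter_upwards [hpoly.ae_ne_zero volume hne] with Θ hΘ n hsep
  refine hsep.le_of_det_ne_zero (X := X) (Y := Y) (fun s b hb => ?_) (fun t b hb => ?_) hΘ
  · have : b ≠ i := fun h => Finset.disjoint_left.1 hAB hi (h ▸ hb)
    simp [X, this]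
  · have : b ≠ j := fun h => Finset.disjoint_left.1 hAB hb (h ▸ hj)
    simp [Y, this]

theorem ae_exists_pow_le_of_hasSep {L H da N k : ℕ} (hk : 3 ^ L = 9 * k) (hdim : 3 ^ L < H * da)
    (hL : 1 ≤ L) (i : Fin N) (p : Fin (H * da)) {A B : Finset (Fin N)} (hAB : Disjoint A B)
    (hU : A ∪ B = Finset.univ) (hA : A.Nonempty) (hB : B.Nonempty) :
    ∃ g : ℕ, H * da - 1 ≤ 2 * k * g ^ 3 ∧
      ∀ᵐ Θ : SAWeights L H da (H * da), ∀ n, HasSep (saOutput L N Θ i p) A B n →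
        g ^ (3 * k) ≤ n := by
  have hk0 : 0 < k := by
    have : 0 < 3 ^ L := by positivity
    lia
  have hK : 3 ^ (L - 1) = 3 * k := by
    obtain ⟨l, rfl⟩ : ∃ l, L = l + 1 := ⟨L - 1, by lia⟩
    rw [pow_succ] at hk
    simp only [Nat.add_sub_cancel]
    lia
  set d := (H * da - 1) / 2 with hd
  set g := (d - 1) / (3 * k) with hg
  have hgd : 3 * k * g ≤ d - 1 := Nat.mul_div_le _ _
  have hdg : d - 1 < 3 * k * (g + 1) := by
    have := Nat.lt_mul_div_succ (d - 1) (show 0 < 3 * k by lia)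
    simpa [hg] using this
  have hg1 : 1 ≤ g := (Nat.one_le_div_iff (by lia)).2 (by lia)
  have hbound : H * da - 1 ≤ 2 * k * (g + 1) ^ 3 := by
    have h1 : H * da - 1 ≤ 6 * k * (g + 1) + 1 := by
      have : d ≤ 3 * k * (g + 1) := by lia
      have : 2 * (3 * k * (g + 1)) = 6 * k * (g + 1) := by ring
      lia
    have h2 : 2 * 2 ≤ (g + 1) * (g + 1) := Nat.mul_le_mul (by lia) (by lia)
    have h3 : 1 * 1 ≤ k * (g + 1) := Nat.mul_le_mul hk0 (by lia)
    nlinarith [Nat.mul_le_mul_left (2 * (k * (g + 1))) h2]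
  refine ⟨g + 1, hbound, ?_⟩
  have hcard := pow_le_card_digit_sums (g := g) (K := 3 ^ (L - 1)) (d := d) (by rw [hK]; lia)
  rcases Finset.mem_union.1 (hU ▸ Finset.mem_univ i : i ∈ A ∪ B) with hi | hi
  · filter_upwards [ae_card_le_of_hasSep hL (by lia) i p hAB hi hB
      fun r : Fin d => digitWeight (g + 1) (3 ^ (L - 1)) r] with Θ hΘ n hn
    exact hK ▸ hcard.trans (hΘ n hn)
  · filter_upwards [ae_card_le_of_hasSep hL (by lia) i p hAB.symm hi hA
      fun r : Fin d => digitWeight (g + 1) (3 ^ (L - 1)) r] with Θ hΘ n hn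
    exact hK ▸ hcard.trans (hΘ n hn.symm)

theorem logb_le_of_le_pow {b C n : ℕ} (hn : n ≤ b ^ C) :
    Real.logb 3 n ≤ C * Real.logb 3 b := by
  rcases Nat.eq_zero_or_pos n with rfl | hpos
  · have : 0 ≤ Real.logb 3 (b : ℝ) := by
      rcases Nat.eq_zero_or_pos b with rfl | hb
      · simp
      · exact Real.logb_nonneg (by norm_num) (by exact_mod_cast hb)
    simpa using by positivity
  · rw [← Real.logb_pow]
    exact Real.logb_le_logb_of_le (by norm_num) (by exact_mod_cast hpos) (by exact_mod_cast hn)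

theorem le_logb_of_pow_le {L H D g n : ℕ} (hL : 2 ≤ L) (hH : 1 ≤ H) (hHD : H ≤ D)
    (hg : D - 1 ≤ 2 * 3 ^ (L - 2) * g ^ 3) (hn : g ^ (3 * 3 ^ (L - 2)) ≤ n) :
    (3 : ℝ) ^ (L - 2) * (Real.logb 3 ((D : ℝ) - (H : ℝ)) - (L : ℝ) + 2 - Real.logb 3 2) ≤
      Real.logb 3 n := by
  have hlogn : 0 ≤ Real.logb 3 (n : ℝ) := by
    rcases Nat.eq_zero_or_pos n with rfl | h
    · simp
    · exact Real.logb_nonneg (by norm_num) (by exact_mod_cast h)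
  have hlog2 : 0 ≤ Real.logb 3 2 := Real.logb_nonneg (by norm_num) (by norm_num)
  have hL2 : (2 : ℝ) ≤ L := by exact_mod_cast hL
  rcases hHD.eq_or_lt with rfl | hlt
  · rw [sub_self, Real.logb_zero]
    exact (mul_nonpos_of_nonneg_of_nonpos (by positivity) (by linarith)).trans hlogn
  have hDH : (0 : ℝ) < (D : ℝ) - H := by
    have : (H : ℝ) < D := by exact_mod_cast hlt
    linarith
  have hle : (D : ℝ) - H ≤ 2 * 3 ^ (L - 2) * (g : ℝ) ^ 3 := by
    have h1 : D ≤ 2 * 3 ^ (L - 2) * g ^ 3 + H := by lia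
    have h2 : (D : ℝ) ≤ 2 * 3 ^ (L - 2) * (g : ℝ) ^ 3 + H := by exact_mod_cast h1
    linarith
  have hg0 : g ≠ 0 := by
    rintro rfl
    norm_num at hle
    linarith
  have hgpos : (0 : ℝ) < g := by exact_mod_cast Nat.pos_of_ne_zero hg0
  have hlog : Real.logb 3 ((D : ℝ) - H) ≤ Real.logb 3 2 + ((L : ℝ) - 2) + 3 * Real.logb 3 g := by
    refine (Real.logb_le_logb_of_le (by norm_num) hDH hle).trans_eq ?_
    rw [Real.logb_mul (by positivity) (by positivity), Real.logb_mul (by norm_num) (by positivity),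
      Real.logb_pow, Real.logb_pow, Real.logb_self_eq_one (by norm_num), Nat.cast_sub hL]
    push_cast
    ring
  have hgn : (3 : ℝ) ^ (L - 2) * (3 * Real.logb 3 g) ≤ Real.logb 3 n := by
    have h1 : (g : ℝ) ^ (3 * 3 ^ (L - 2)) ≤ n := by exact_mod_cast hn
    refine le_trans (le_of_eq ?_) (Real.logb_le_logb_of_le (by norm_num) (by positivity) h1)
    rw [Real.logb_pow]
    push_cast
    ring
  refine (mul_le_mul_of_nonneg_left ?_ (by positivity)).trans hgn
  linarith

/-- Theorem 1 of the paper: in the regime `L < log₃ d_x`, for all weight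
configurations Θ but a set of Lebesgue measure zero, the (finite) separation rank of
`y_p^{i,L,d_x,H,Θ}` w.r.t. any balanced partition satisfies
`3^{L-2}·(log₃(d_x−H) − L + 2 − log₃2) ≤ log₃ sep ≤ ((3^L−1)/2)·log₃(d_x+H)`. -/
theorem depth_efficiency_regime_sepRank_bounds
    {L H da dx N : ℕ} (hN : 1 < N) (hNeven : Even N) (hL : 2 ≤ L)
    (hdxda : dx = H * da)
    (hregime : (L : ℝ) < Real.logb 3 dx)
    (i : Fin N) (p : Fin dx) :
    volume {Θ : SAWeights L H da dx |
      ¬ ∀ A B : Finset (Fin N), Disjoint A B → A ∪ B = Finset.univ →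
          A.card = N / 2 → B.card = N / 2 →
          ∃ n : ℕ, sepRank (saOutput L N Θ i p) A B = (n : ℕ∞) ∧
            (3 : ℝ) ^ (L - 2) *
                (Real.logb 3 ((dx : ℝ) - (H : ℝ)) - (L : ℝ) + 2 - Real.logb 3 2) ≤
              Real.logb 3 (n : ℝ) ∧
            Real.logb 3 (n : ℝ) ≤
              (((3 : ℝ) ^ L - 1) / 2) * Real.logb 3 ((dx : ℝ) + (H : ℝ))} = 0 := by
  have hdx : 3 ^ L < dx := by
    have hpos : (0 : ℝ) < dx := by
      rcases Nat.eq_zero_or_pos dx with rfl | h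
      · simp at hregime
        linarith [(Nat.cast_nonneg L : (0 : ℝ) ≤ L)]
      · exact_mod_cast h
    rw [Real.lt_logb_iff_rpow_lt (by norm_num) hpos, Real.rpow_natCast] at hregime
    exact_mod_cast hregime
  subst hdxda
  have hk : 3 ^ L = 9 * 3 ^ (L - 2) := by
    obtain ⟨l, rfl⟩ : ∃ l, L = l + 2 := ⟨L - 2, by lia⟩
    simp only [Nat.add_sub_cancel]
    ring
  have hda : 1 ≤ da := Nat.one_le_iff_ne_zero.2 (by rintro rfl; simp at hdx)
  have hH : 1 ≤ H := Nat.one_le_iff_ne_zero.2 (by rintro rfl; simp at hdx)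
  change ∀ᵐ Θ : SAWeights L H da (H * da), ∀ A B : Finset (Fin N), _
  simp only [eventually_countable_forall]
  intro A B hdisj hU hA hB
  obtain ⟨g, hg, hae⟩ := ae_exists_pow_le_of_hasSep hk hdx (by lia) i p hdisj hU
    (Finset.card_pos.1 (by lia)) (Finset.card_pos.1 (by lia))
  filter_upwards [hae] with Θ hΘ
  obtain ⟨n, hn, hle, hsep⟩ := (hasSep_saOutput Θ i p hdisj hU).exists_sepRank_eq
  refine ⟨n, hn, le_logb_of_pow_le hL hH (Nat.le_mul_of_pos_right _ hda) hg (hΘ n hsep), ?_⟩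
  have hC : ((3 : ℝ) ^ L - 1) / 2 = wordLength L := by
    have : (2 * wordLength L + 1 : ℝ) = 3 ^ L := by
      exact_mod_cast two_mul_wordLength_add_one L
    linarith
  rw [hC]
  exact_mod_cast logb_le_of_le_pow hle
end

section
/- (Structure of deep self-attention.) Define C(L) := (3^L − 1)/2. For any depth L ≥ 1 and any weight configuration Θ, there exist matrices A^{(c,h)}, B^{(c,h)} ∈ ℝ^{d_a×d_x} for every multi-index h ∈ [H]^{C(L)} and every 0 ≤ c ≤ C(L), such that for all input matrices X ∈ ℝ^{d_x×N}, the matrix Y^{L,d_x,H,Θ}(X) ∈ ℝ^{d_x×N} whose j-th column is the network output at position j equals Σ_{h ∈ [H]^{C(L)}} B^{(0,h)T} M^{(1,h)} ⋯ M^{(C(L),h)} A^{(0,h)} X, where M^{(c,h)} := A^{(c,h)} X X^T B^{(c,h)T} for 1 ≤ c ≤ C(L). -/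
open scoped BigOperators
open MeasureTheory Matrix

set_option synthInstance.maxSize 4000

/-- `C(L) = (3^L − 1)/2`. -/
def CL (L : ℕ) : ℕ := (3 ^ L - 1) / 2

/-- The output matrix `Y^{L,d_x,H,Θ}(X) ∈ ℝ^{d_x×N}` of the depth-`L` network, whose `j`-th
column is the network output at position `j`, on the input matrix `X ∈ ℝ^{d_x×N}`. -/
noncomputable def saNetMatrix {H da dx : ℕ} (L N : ℕ) (Θ : SAWeights L H da dx)
    (X : Matrix (Fin dx) (Fin N) ℝ) : Matrix (Fin dx) (Fin N) ℝ :=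
  Matrix.of fun p j => saNetAux (extendW Θ) L (fun j' p' => X p' j') j p

/-- `f` is a product of `n` factors of the form `X ↦ P X Xᵀ Q` with constant `P` and `Q`. -/
def IsGramProduct {m d N : ℕ} (n : ℕ)
    (f : Matrix (Fin d) (Fin N) ℝ → Matrix (Fin m) (Fin m) ℝ) : Prop :=
  ∃ P : List (Matrix (Fin m) (Fin d) ℝ × Matrix (Fin d) (Fin m) ℝ), P.length = n ∧
    ∀ X, f X = (P.map fun p => p.1 * X * Xᵀ * p.2).prod

namespace IsGramProduct

variable {m d N : ℕ}

theorem single (P : Matrix (Fin m) (Fin d) ℝ) (Q : Matrix (Fin d) (Fin m) ℝ) :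
    IsGramProduct 1 fun X : Matrix (Fin d) (Fin N) ℝ => P * X * Xᵀ * Q :=
  ⟨[(P, Q)], rfl, fun X => by simp⟩

theorem mul {n k : ℕ} {f g : Matrix (Fin d) (Fin N) ℝ → Matrix (Fin m) (Fin m) ℝ}
    (hf : IsGramProduct n f) (hg : IsGramProduct k g) :
    IsGramProduct (n + k) fun X => f X * g X := by
  obtain ⟨P, hP, hf⟩ := hf
  obtain ⟨Q, hQ, hg⟩ := hg
  exact ⟨P ++ Q, by simp [hP, hQ], fun X => by simp [hf, hg]⟩

theorem transpose {n : ℕ} {f : Matrix (Fin d) (Fin N) ℝ → Matrix (Fin m) (Fin m) ℝ}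
    (hf : IsGramProduct n f) : IsGramProduct n fun X => (f X)ᵀ := by
  obtain ⟨P, hP, hf⟩ := hf
  refine ⟨(P.map fun p => (p.2ᵀ, p.1ᵀ)).reverse, by simp [hP], fun X => ?_⟩
  dsimp only
  rw [hf, Matrix.transpose_list_prod, List.map_map, List.map_reverse, List.map_map]
  simp [Function.comp_def, Matrix.mul_assoc]

theorem const_mul {n : ℕ} {f : Matrix (Fin d) (Fin N) ℝ → Matrix (Fin m) (Fin m) ℝ}
    (hn : n ≠ 0) (hf : IsGramProduct n f) (E : Matrix (Fin m) (Fin m) ℝ) :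
    IsGramProduct n fun X => E * f X := by
  obtain ⟨P, hP, hf⟩ := hf
  cases P with
  | nil => exact absurd hP.symm hn
  | cons p P =>
    exact ⟨(E * p.1, p.2) :: P, by simpa using hP, fun X => by simp [hf, Matrix.mul_assoc]⟩

end IsGramProduct

/-- `F X` is a sum of `H ^ n` terms of the form `B * f X * A * X`, where each `f` is a product of
`n` Gram factors. -/
def HasGramExpansion {d N : ℕ} (H m n : ℕ)
    (F : Matrix (Fin d) (Fin N) ℝ → Matrix (Fin d) (Fin N) ℝ) : Prop :=
  ∃ (ι : Type) (_ : Fintype ι) (B : ι → Matrix (Fin d) (Fin m) ℝ)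
    (f : ι → Matrix (Fin d) (Fin N) ℝ → Matrix (Fin m) (Fin m) ℝ)
    (A : ι → Matrix (Fin m) (Fin d) ℝ), Fintype.card ι = H ^ n ∧ (∀ i, IsGramProduct n (f i)) ∧
      ∀ X, F X = ∑ i, B i * f i X * A i * X

/-- The matrix form of a self-attention layer. -/
def saLayerMatrix {N H da dx : ℕ} (W : Fin H → HeadWeights da dx)
    (X : Matrix (Fin dx) (Fin N) ℝ) : Matrix (Fin dx) (Fin N) ℝ :=
  ∑ h, Matrix.of (W h).2.2.2 * Matrix.of (W h).2.2.1 * X * Xᵀ * (Matrix.of (W h).1)ᵀ *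
    Matrix.of (W h).2.1 * X

theorem transpose_saLayer {N H da dx : ℕ} (W : Fin H → HeadWeights da dx)
    (x : Fin N → Fin dx → ℝ) :
    (Matrix.of (saLayer W x))ᵀ = saLayerMatrix W (Matrix.of x)ᵀ := by
  ext p i
  simp only [saLayerMatrix, Matrix.sum_apply, Matrix.transpose_apply, Matrix.of_apply, saLayer,
    Finset.sum_apply, Pi.smul_apply, smul_eq_mul]
  rw [Finset.sum_comm]
  refine Finset.sum_congr rfl fun h _ => ?_
  obtain ⟨K, Q, V, O⟩ := W h
  simp only
  have regroup : of O * of V * (of x)ᵀ * (of x)ᵀᵀ * (of K)ᵀ * of Q * (of x)ᵀ =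
      (of O * (of V * (of x)ᵀ)) * ((of K * (of x)ᵀ)ᵀ * (of Q * (of x)ᵀ)) := by
    simp only [Matrix.transpose_mul, Matrix.mul_assoc]
  rw [regroup, Matrix.mul_apply]
  refine Finset.sum_congr rfl fun j _ => ?_
  rw [mul_comm, Matrix.mul_apply (M := (of K * (of x)ᵀ)ᵀ)]
  congr 1
  exact Finset.sum_congr rfl fun a _ => mul_comm _ _

theorem hasGramExpansion_saLayerMatrix {N H da dx : ℕ} (W : Fin H → HeadWeights da dx) :
    HasGramExpansion H da 1 (saLayerMatrix (N := N) W) :=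
  ⟨Fin H, inferInstance, fun h => of (W h).2.2.2,
    fun h X => of (W h).2.2.1 * X * Xᵀ * (of (W h).1)ᵀ, fun h => of (W h).2.1, by simp,
    fun _ => .single _ _, fun X => by simp only [saLayerMatrix, Matrix.mul_assoc]⟩

theorem HasGramExpansion.saLayerMatrix_comp {N H da dx n : ℕ} (hn : n ≠ 0)
    (W : Fin H → HeadWeights da dx)
    {F : Matrix (Fin dx) (Fin N) ℝ → Matrix (Fin dx) (Fin N) ℝ}
    (hF : HasGramExpansion H da n F) :
    HasGramExpansion H da (3 * n + 1) fun X => saLayerMatrix W (F X) := by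
  obtain ⟨ι, _, B, f, A, hcard, hf, hF⟩ := hF
  refine ⟨Fin H × ι × ι × ι, inferInstance,
    fun t => of (W t.1).2.2.2 * of (W t.1).2.2.1 * B t.2.1,
    fun t X => f t.2.1 X * (A t.2.1 * X * Xᵀ * (A t.2.2.1)ᵀ) * (f t.2.2.1 X)ᵀ *
      ((B t.2.2.1)ᵀ * (of (W t.1).1)ᵀ * of (W t.1).2.1 * B t.2.2.2 * f t.2.2.2 X),
    fun t => A t.2.2.2, ?_, fun t => ?_, fun X => ?_⟩
  · simp only [Fintype.card_prod, Fintype.card_fin, hcard]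
    ring
  · have hlen : 3 * n + 1 = n + 1 + n + n := by ring
    rw [hlen]
    exact (((hf _).mul (.single _ _)).mul (hf _).transpose).mul ((hf _).const_mul hn _)
  · simp only [saLayerMatrix, hF, Fintype.sum_prod_type, Matrix.transpose_sum, Matrix.mul_sum,
      Matrix.sum_mul, Matrix.transpose_mul, Matrix.mul_assoc]
    refine Finset.sum_congr rfl fun h _ => ?_
    rw [Finset.sum_comm_cycle]
    exact Finset.sum_congr rfl fun i _ => Finset.sum_comm

theorem CL_succ (L : ℕ) : CL (L + 1) = 3 * CL L + 1 := by
  have hodd : 3 ^ L % 2 = 1 := Nat.odd_iff.mp (Odd.pow (by decide))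
  simp only [CL, pow_succ]
  omega

theorem hasGramExpansion_saNetAux {N H da dx : ℕ} (W : ℕ → Fin H → HeadWeights da dx) (l : ℕ) :
    HasGramExpansion H da (CL (l + 1)) fun X : Matrix (Fin dx) (Fin N) ℝ =>
      (Matrix.of (saNetAux W (l + 1) fun j p => X p j))ᵀ := by
  induction l with
  | zero =>
    have hlayer : (fun X : Matrix (Fin dx) (Fin N) ℝ =>
        (Matrix.of (saNetAux W (0 + 1) fun j p => X p j))ᵀ) = saLayerMatrix (W 0) :=
      funext fun X => transpose_saLayer (W 0) _
    rw [hlayer]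
    exact hasGramExpansion_saLayerMatrix (W 0)
  | succ l ih =>
    have hlayer : (fun X : Matrix (Fin dx) (Fin N) ℝ =>
        (Matrix.of (saNetAux W (l + 1 + 1) fun j p => X p j))ᵀ) =
        fun X => saLayerMatrix (W (l + 1)) (Matrix.of (saNetAux W (l + 1) fun j p => X p j))ᵀ :=
      funext fun X => transpose_saLayer (W (l + 1)) _
    rw [CL_succ (l + 1), hlayer]
    exact ih.saLayerMatrix_comp (by rw [CL_succ]; omega) (W (l + 1))

/-- Lemma 1 of the paper: any depth-`L` composition of self-attention
layers can be written as
`Y^{L,d_x,H,Θ}(X) = Σ_{h∈[H]^{C(L)}} B^{(0,h)ᵀ} M^{(1,h)} ⋯ M^{(C(L),h)} A^{(0,h)} X`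
with `M^{(c,h)} = A^{(c,h)} X Xᵀ B^{(c,h)ᵀ}`, `A^{(c,h)}, B^{(c,h)} ∈ ℝ^{d_a×d_x}`. -/
theorem sa_network_structure
    {L H da dx : ℕ} (hL : 1 ≤ L) (hdxda : dx = H * da) (N : ℕ)
    (Θ : SAWeights L H da dx) :
    ∃ A B : (Fin (CL L) → Fin H) → Fin (CL L + 1) → Matrix (Fin da) (Fin dx) ℝ,
      ∀ X : Matrix (Fin dx) (Fin N) ℝ,
        saNetMatrix L N Θ X =
          ∑ h : Fin (CL L) → Fin H,
            (B h 0)ᵀ *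
              (((List.finRange (CL L)).map
                  (fun c => A h c.succ * X * Xᵀ * (B h c.succ)ᵀ)).prod) *
              (A h 0) * X := by
  obtain ⟨l, rfl⟩ := Nat.exists_eq_add_of_le' hL
  obtain ⟨ι, _, B, f, A, hcard, hf, hF⟩ := hasGramExpansion_saNetAux (N := N) (extendW Θ) l
  choose P hP hfP using hf
  let e : (Fin (CL (l + 1)) → Fin H) ≃ ι := Fintype.equivOfCardEq (by simp [hcard])
  refine ⟨fun h => Fin.cons (A (e h)) fun c => ((P (e h)).get (c.cast (hP _).symm)).1,
    fun h => Fin.cons (B (e h))ᵀ fun c => ((P (e h)).get (c.cast (hP _).symm)).2ᵀ, fun X => ?_⟩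
  refine (hF X).trans ((e.sum_comp _).symm.trans (Finset.sum_congr rfl fun h _ => ?_))
  simp only [Fin.cons_zero, Fin.cons_succ, Matrix.transpose_transpose]
  congr 3
  rw [hfP]
  congr 1
  refine List.ext_getElem (by simp [hP]) fun c _ _ => ?_
  simp
end

section
/- (Separation rank growth under one self-attention layer.) Fix a partition of [N] into disjoint A, B with A ∪ B = [N]. Let g^1,…,g^N : (ℝ^{d_x})^N → ℝ^{d_x} be functions such that every scalar coordinate satisfies sep(g_p^j; A, B) ≤ K for all p ∈ [d_x], j ∈ [N]. Let y^i : (ℝ^{d_x})^N → ℝ^{d_x} be the result of applying a single self-attention layer (with any weights W^{Q,h}, W^{K,h}, W^{V,h} ∈ ℝ^{d_a×d_x}, W^{O,h} ∈ ℝ^{d_x×d_a}, h ∈ [H], d_a = d_x/H) to the tuple (g^1,…,g^N), i.e. y^i = Σ_{j=1}^N Σ_{h=1}^H ⟨W^{Q,h} g^i, W^{K,h} g^j⟩ W^{O,h} W^{V,h} g^j. Then for every p ∈ [d_x]: sep(y_p^i; A, B) ≤ (N·d_x⁴/H)·K³. -/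
open scoped BigOperators
open MeasureTheory Matrix

set_option synthInstance.maxSize 4000

/-- A decomposition of `f` indexed by a finite type bounds its separation rank by the
cardinality of that type. -/
theorem sepRank_le_card {N dx : ℕ} {f : (Fin N → Fin dx → ℝ) → ℝ} {A B : Finset (Fin N)}
    {ι : Type*} [Fintype ι] (u v : ι → (Fin N → Fin dx → ℝ) → ℝ)
    (hu : ∀ r, DependsOnlyOn (u r) A) (hv : ∀ r, DependsOnlyOn (v r) B)
    (hf : ∀ x, f x = ∑ r, u r x * v r x) :
    sepRank f A B ≤ (Fintype.card ι : ℕ∞) := by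
  refine sInf_le ⟨Fintype.card ι, rfl, fun r => u ((Fintype.equivFin ι).symm r),
    fun r => v ((Fintype.equivFin ι).symm r), fun r => hu _, fun r => hv _, fun x => ?_⟩
  rw [hf x, ← (Fintype.equivFin ι).symm.sum_comp]

/-- A function of separation rank at most `K` is a sum of exactly `K` separable products. -/
theorem exists_decomposition_of_sepRank_le {N dx : ℕ} {f : (Fin N → Fin dx → ℝ) → ℝ}
    {A B : Finset (Fin N)} {K : ℕ} (h : sepRank f A B ≤ (K : ℕ∞)) :
    ∃ u v : Fin K → (Fin N → Fin dx → ℝ) → ℝ,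
      (∀ r, DependsOnlyOn (u r) A) ∧ (∀ r, DependsOnlyOn (v r) B) ∧
      ∀ x, f x = ∑ r, u r x * v r x := by
  have hlt : sepRank f A B < ((K + 1 : ℕ) : ℕ∞) :=
    lt_of_le_of_lt h (by exact_mod_cast Nat.lt_succ_self K)
  obtain ⟨_, ⟨n, rfl, u, v, hu, hv, hf⟩, hn⟩ := sInf_lt_iff.1 hlt
  have hnK : n ≤ K := Nat.lt_succ_iff.1 (by exact_mod_cast hn)
  obtain ⟨m, rfl⟩ := Nat.exists_eq_add_of_le hnK
  refine ⟨Fin.append u fun _ _ => 0, Fin.append v fun _ _ => 0, fun r => ?_, fun r => ?_,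
    fun x => ?_⟩
  · refine Fin.addCases (fun r => ?_) (fun r => ?_) r
    · simpa using hu r
    · simp [DependsOnlyOn]
  · refine Fin.addCases (fun r => ?_) (fun r => ?_) r
    · simpa using hv r
    · simp [DependsOnlyOn]
  · simp [Fin.sum_univ_add, hf x]

/-- Functions depending only on the positions in `A` are closed under products. -/
theorem DependsOnlyOn.mul {N dx : ℕ} {f f' : (Fin N → Fin dx → ℝ) → ℝ} {A : Finset (Fin N)}
    (hf : DependsOnlyOn f A) (hf' : DependsOnlyOn f' A) :
    DependsOnlyOn (fun x => f x * f' x) A :=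
  fun x y hxy => congrArg₂ (· * ·) (hf x y hxy) (hf' x y hxy)

/-- Scalar multiples preserve the set of positions a function depends on. -/
theorem DependsOnlyOn.const_mul {N dx : ℕ} {f : (Fin N → Fin dx → ℝ) → ℝ} {A : Finset (Fin N)}
    (hf : DependsOnlyOn f A) (c : ℝ) : DependsOnlyOn (fun x => c * f x) A :=
  fun x y hxy => congrArg (c * ·) (hf x y hxy)

/-- The coefficient of `x^i_{q.1} · x^j_{q.2.1} · x^j_{q.2.2}` in the `p`-th output coordinate
of a self-attention layer at position `i`. -/
noncomputable def saCoeff {H da dx : ℕ} (W : Fin H → HeadWeights da dx) (p : Fin dx)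
    (q : Fin dx × Fin dx × Fin dx) : ℝ :=
  ∑ h, ∑ a, ∑ b, (W h).2.1 a q.1 * (W h).1 a q.2.1 * ((W h).2.2.2 p b * (W h).2.2.1 b q.2.2)

/-- A self-attention layer is a cubic form in its inputs. -/
theorem saLayer_apply_eq_sum {N H da dx : ℕ} (W : Fin H → HeadWeights da dx)
    (x : Fin N → Fin dx → ℝ) (i : Fin N) (p : Fin dx) :
    saLayer W x i p = ∑ j, ∑ q : Fin dx × Fin dx × Fin dx,
      saCoeff W p q * (x i q.1 * (x j q.2.1 * x j q.2.2)) := by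
  simp only [saLayer, Finset.sum_apply, Pi.smul_apply, smul_eq_mul, saCoeff, Finset.sum_mul]
  refine Finset.sum_congr rfl fun j _ => ?_
  conv_rhs => rw [Finset.sum_comm]
  refine Finset.sum_congr rfl fun h _ => ?_
  conv_rhs => rw [Finset.sum_comm]
  refine Finset.sum_congr rfl fun a _ => ?_
  conv_rhs => rw [Finset.sum_comm]
  simp only [Matrix.mulVec, dotProduct, Matrix.of_apply]
  rw [Finset.mul_sum]
  refine Finset.sum_congr rfl fun b _ => ?_
  simp only [Fintype.sum_prod_type]
  rw [Finset.sum_mul_sum, Finset.sum_mul]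
  refine Finset.sum_congr rfl fun q _ => ?_
  rw [Finset.sum_mul]
  refine Finset.sum_congr rfl fun r _ => ?_
  rw [Finset.mul_sum, Finset.mul_sum]
  refine Finset.sum_congr rfl fun s _ => ?_
  ring

/-- Lemma 2 of the paper, separation rank growth under one self-attention
layer: if every scalar coordinate of the (vector-valued) input functions `g^j` has
separation rank at most `K` w.r.t. `(A,B)`, then after one self-attention layer every
output coordinate has separation rank at most `(N·d_x⁴/H)·K³`. -/
theorem sepRank_one_selfAttention_layer
    {N H da dx : ℕ} (hdxda : dx = H * da)
    (A B : Finset (Fin N)) (hAB : Disjoint A B) (hABcov : A ∪ B = Finset.univ)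
    (g : Fin N → (Fin N → Fin dx → ℝ) → (Fin dx → ℝ)) (K : ℕ)
    (hg : ∀ (j : Fin N) (p : Fin dx), sepRank (fun x => g j x p) A B ≤ (K : ℕ∞))
    (W : Fin H → HeadWeights da dx) (i : Fin N) (p : Fin dx) :
    sepRank (fun x => saLayer W (fun j => g j x) i p) A B ≤
      ((N * dx ^ 4 / H * K ^ 3 : ℕ) : ℕ∞) := by
  choose u v hu hv huv using fun j q => exists_decomposition_of_sepRank_le (hg j q)
  have hH : 0 < H := Nat.pos_of_ne_zero fun h => (hdxda ▸ p.pos).ne' (by simp [h])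
  have hda : 0 < da := Nat.pos_of_ne_zero fun h => (hdxda ▸ p.pos).ne' (by simp [h])
  have hdiv : N * dx ^ 4 / H = N * dx ^ 3 * da := by
    apply Nat.div_eq_of_eq_mul_right hH
    rw [pow_succ dx 3]
    nth_rw 2 [hdxda]
    ring
  have hcard : sepRank (fun x => saLayer W (fun j => g j x) i p) A B ≤
      (Fintype.card ((Fin N × (Fin dx × Fin dx × Fin dx)) × (Fin K × Fin K × Fin K)) : ℕ∞) := by
    refine sepRank_le_card
      (fun t x => saCoeff W p t.1.2 * (u i t.1.2.1 t.2.1 x *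
        (u t.1.1 t.1.2.2.1 t.2.2.1 x * u t.1.1 t.1.2.2.2 t.2.2.2 x)))
      (fun t x => v i t.1.2.1 t.2.1 x *
        (v t.1.1 t.1.2.2.1 t.2.2.1 x * v t.1.1 t.1.2.2.2 t.2.2.2 x))
      (fun t => ((hu _ _ _).mul ((hu _ _ _).mul (hu _ _ _))).const_mul _)
      (fun t => (hv _ _ _).mul ((hv _ _ _).mul (hv _ _ _))) fun x => ?_
    rw [saLayer_apply_eq_sum, Fintype.sum_prod_type, Fintype.sum_prod_type]
    refine Finset.sum_congr rfl fun j _ => Finset.sum_congr rfl fun q _ => ?_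
    rw [huv i q.1 x, huv j q.2.1 x, huv j q.2.2 x, Finset.sum_mul_sum, Finset.sum_mul,
      Finset.mul_sum, Fintype.sum_prod_type]
    refine Finset.sum_congr rfl fun r _ => ?_
    rw [Finset.mul_sum, Finset.mul_sum, Fintype.sum_prod_type]
    refine Finset.sum_congr rfl fun s _ => ?_
    rw [Finset.mul_sum, Finset.mul_sum]
    refine Finset.sum_congr rfl fun t _ => ?_
    ring
  refine hcard.trans (Nat.cast_le.2 ?_)
  simp only [Fintype.card_prod, Fintype.card_fin]
  calc N * (dx * (dx * dx)) * (K * (K * K)) = N * dx ^ 3 * 1 * K ^ 3 := by ring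
    _ ≤ N * dx ^ 3 * da * K ^ 3 := by gcongr; exact hda
    _ = N * dx ^ 4 / H * K ^ 3 := by rw [hdiv]
end

section
/- (Inequality of arithmetic and geometric multiset-coefficient means.) Let n ≥ 1 and k ≥ 1 be natural numbers, let r₁,…,r_k ∈ ℕ, and set M := Σ_{j=1}^k r_j. Then ∏_{j=1}^k ((n choose r_j)) ≤ ( ∏_{t=1}^{n−1} (M/k + t) )^k / ((n−1)!)^k, where ((n choose r)) := binomial(n + r − 1, r) is the multiset coefficient. Moreover, when k divides M, equality holds for r₁ = … = r_k = M/k. -/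
open scoped BigOperators

/-- The multiset coefficient `((m + 1) multichoose a)` as a polynomial of degree `m` in `a`. -/
theorem multichoose_succ_eq_prod_div (m a : ℕ) :
    (Nat.multichoose (m + 1) a : ℝ) =
      (∏ t ∈ Finset.Icc 1 m, ((a : ℝ) + (t : ℝ))) / (Nat.factorial m : ℝ) := by
  have hfac : (Nat.factorial m : ℝ) ≠ 0 := by exact_mod_cast m.factorial_ne_zero
  rw [eq_div_iff hfac, Nat.multichoose_eq, show m + 1 + a - 1 = a + m by omega,
    Nat.choose_symm_add, mul_comm]
  have h := Nat.ascFactorial_eq_factorial_mul_choose a m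
  rw [← Nat.cast_mul, ← h, Nat.ascFactorial_eq_prod_range, ← Finset.Ico_add_one_right_eq_Icc,
    Finset.prod_Ico_eq_prod_range, Nat.cast_prod]
  refine Finset.prod_congr (by simp) fun i _ => ?_
  push_cast
  ring

/-- The inequality of arithmetic and geometric means, in the form without roots. -/
theorem prod_le_mean_pow_card {k : ℕ} (hk : k ≠ 0) (z : Fin k → ℝ) (hz : ∀ j, 0 ≤ z j) :
    ∏ j, z j ≤ ((∑ j, z j) / k) ^ k := by
  have h := Real.geom_mean_le_arith_mean Finset.univ (fun _ => (1 : ℝ)) z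
    (fun _ _ => zero_le_one) (by simpa using Nat.pos_of_ne_zero hk) (fun j _ => hz j)
  simp only [Real.rpow_one, Finset.sum_const, Finset.card_univ, Fintype.card_fin, nsmul_eq_mul,
    mul_one, one_mul] at h
  have hprod : 0 ≤ ∏ j, z j := Finset.prod_nonneg fun j _ => hz j
  calc ∏ j, z j = ((∏ j, z j) ^ ((k : ℝ)⁻¹)) ^ k := (Real.rpow_inv_natCast_pow hprod hk).symm
    _ ≤ ((∑ j, z j) / k) ^ k := by gcongr

/-- Lemma 3 of the paper, inequality of arithmetic and geometric
multiset-coefficient means: for `n, k ≥ 1`, `r₁,…,r_k ∈ ℕ` and `M := Σ_j r_j`,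
`∏_j ((n multichoose r_j)) ≤ (∏_{t=1}^{n−1} (M/k + t))^k / ((n−1)!)^k`, where
`((n multichoose r)) = binomial(n+r−1, r)`; moreover, when `k ∣ M`, equality holds for
`r₁ = … = r_k = M/k`. -/
theorem multichoose_am_gm (n k : ℕ) (hn : 1 ≤ n) (hk : 1 ≤ k) (r : Fin k → ℕ) :
    ((∏ j, (Nat.multichoose n (r j) : ℝ)) ≤
        (∏ t ∈ Finset.Icc 1 (n - 1), (((∑ j, r j : ℕ) : ℝ) / (k : ℝ) + (t : ℝ))) ^ k /
          ((Nat.factorial (n - 1) : ℝ)) ^ k) ∧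
      ((k ∣ ∑ j, r j) → (∀ j, r j = (∑ j', r j') / k) →
        (∏ j, (Nat.multichoose n (r j) : ℝ)) =
          (∏ t ∈ Finset.Icc 1 (n - 1), (((∑ j, r j : ℕ) : ℝ) / (k : ℝ) + (t : ℝ))) ^ k /
            ((Nat.factorial (n - 1) : ℝ)) ^ k) := by
  obtain ⟨m, rfl⟩ : ∃ m, n = m + 1 := ⟨n - 1, by omega⟩
  have hk0 : k ≠ 0 := by omega
  have hkR : (k : ℝ) ≠ 0 := by exact_mod_cast hk0
  simp only [Nat.add_sub_cancel, multichoose_succ_eq_prod_div]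
  refine ⟨?_, fun hdvd hr => ?_⟩
  · rw [Finset.prod_div_distrib, Finset.prod_const, Finset.card_univ, Fintype.card_fin,
      Finset.prod_comm, ← Finset.prod_pow]
    gcongr with t
    refine (prod_le_mean_pow_card hk0 (fun j => (r j : ℝ) + t) fun j => by positivity).trans_eq ?_
    congr 1
    simp only [Finset.sum_add_distrib, Finset.sum_const, Finset.card_univ, Fintype.card_fin,
      nsmul_eq_mul, Nat.cast_sum]
    field_simp
  · have hmean : ∀ j, (r j : ℝ) = ((∑ j, r j : ℕ) : ℝ) / (k : ℝ) := fun j => by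
      rw [← Nat.cast_div hdvd hkR, ← hr j]
    simp only [hmean, Finset.prod_const, Finset.card_univ, Fintype.card_fin, div_pow]
end

section
/- (Weight assignment realizing Hadamard powers of Gram matrices.) Let the depth-L self-attention network have width d_x, H heads, attention dimension d_a = d_x/H with d_a odd, and L ≥ 2; let N > 1 be even. For any balanced partition (I, J) of [N], any even M ≥ 2, and any matrix V ∈ ℝ^{(M/2) × ((d_x − H)/2)} whose rows are ℓ²-normalized, there exist M+1 template vectors x^{(1)},…,x^{(M+1)} ∈ ℝ^{d_x} and an assignment of the network's weight matrices (with complex entries) such that the (M/2)×(M/2) submatrix of the matricized grid tensor ⟦A(y_p^{i,L,d_x,H,Θ})⟧_{I,J} obtained by restricting rows to index tuples whose first I-coordinate ranges over [M/2] and all other coordinates equal M+1, and columns to index tuples whose first J-coordinate ranges over {M/2+1,…,M} and all other coordinates equal M+1, equals a nonzero constant times (V Vᵀ)^{⊙3^{L−2}}, where ⊙ denotes the entrywise (Hadamard) power: (A^{⊙k})_{ij} = (A_{ij})^k. -/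
open scoped BigOperators
open Matrix

/-- Per-head weights `(W^K, W^Q, W^V, W^O)` with complex entries. -/
abbrev HeadWeightsC (da dx : ℕ) : Type :=
  Matrix (Fin da) (Fin dx) ℂ × Matrix (Fin da) (Fin dx) ℂ ×
  Matrix (Fin da) (Fin dx) ℂ × Matrix (Fin dx) (Fin da) ℂ

/-- A single (multi-headed) self-attention layer with complex weights:
`y^i = Σ_{j=1}^N Σ_{h=1}^H ⟨W^{Q,h} x^i, W^{K,h} x^j⟩ W^{O,h} W^{V,h} x^j`
(the same bilinear formula as in the real case). -/
noncomputable def saLayerC {N H da dx : ℕ} (W : Fin H → HeadWeightsC da dx)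
    (x : Fin N → Fin dx → ℂ) : Fin N → Fin dx → ℂ := fun i =>
  ∑ j : Fin N, ∑ h : Fin H,
    (∑ a : Fin da, (W h).2.1.mulVec (x i) a * (W h).1.mulVec (x j) a) •
      (W h).2.2.2.mulVec ((W h).2.2.1.mulVec (x j))

/-- `l`-fold composition of complex self-attention layers. -/
noncomputable def saNetAuxC {N H da dx : ℕ} (W : ℕ → Fin H → HeadWeightsC da dx) :
    ℕ → (Fin N → Fin dx → ℂ) → (Fin N → Fin dx → ℂ)
  | 0, x => x
  | (l + 1), x => saLayerC (W l) (saNetAuxC W l x)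

noncomputable def extendWC {L H da dx : ℕ} (Θ : Fin L → Fin H → HeadWeightsC da dx) :
    ℕ → Fin H → HeadWeightsC da dx := fun l =>
  if h : l < L then Θ ⟨l, h⟩ else fun _ => 0

/-- `y_p^{i,L,d_x,H,Θ}` for complex weights. -/
noncomputable def saOutputC {H da dx : ℕ} (L N : ℕ) (Θ : Fin L → Fin H → HeadWeightsC da dx)
    (i : Fin N) (p : Fin dx) (x : Fin N → Fin dx → ℂ) : ℂ :=
  saNetAuxC (extendWC Θ) L x i p

/-- A head whose query and key both read the coordinate `c`, so that the attention score is
`x i c * x j c`, and whose values copy the block of coordinates `e (h, ·)`. -/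
noncomputable def copyHead {H da dx : ℕ} (e : Fin H × Fin da ≃ Fin dx) (a₀ : Fin da)
    (c : Fin dx) (h : Fin H) : HeadWeightsC da dx :=
  (Matrix.single a₀ c 1, Matrix.single a₀ c 1,
    (1 : Matrix (Fin dx) (Fin dx) ℂ).submatrix (fun a => e (h, a)) id,
    (1 : Matrix (Fin dx) (Fin dx) ℂ).submatrix id (fun a => e (h, a)))

/-- A head computing its share of the bilinear form `(P *ᵥ s) ⬝ᵥ (R *ᵥ s)`, the rows of `P` and `R`
being split among the heads by `e`; the result is multiplied by coordinate `c` and written to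
coordinate `p`. -/
noncomputable def bilinHead {H da dx : ℕ} {κ : Type*} (e : Fin H × Fin da ≃ κ) (a₀ : Fin da)
    (P R : Matrix κ (Fin dx) ℂ) (c p : Fin dx) (h : Fin H) : HeadWeightsC da dx :=
  (R.submatrix (fun a => e (h, a)) id, P.submatrix (fun a => e (h, a)) id,
    Matrix.single a₀ c 1, Matrix.single p a₀ 1)

lemma single_one_mulVec_apply {m n : Type*} [DecidableEq m] [DecidableEq n] [Fintype n]
    (a : m) (c : n) (v : n → ℂ) (b : m) :
    (Matrix.single a c (1 : ℂ) *ᵥ v) b = if b = a then v c else 0 := by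
  rw [Matrix.single_mulVec, Function.update_apply]
  simp

lemma saLayerC_copyHead {N H da dx : ℕ} (e : Fin H × Fin da ≃ Fin dx) (a₀ : Fin da)
    (c : Fin dx) (x : Fin N → Fin dx → ℂ) (hx : ∀ j, x j c = 1) :
    saLayerC (copyHead e a₀ c) x = fun _ => ∑ j, x j := by
  funext i
  refine Finset.sum_congr rfl fun j _ => ?_
  funext k
  have hV : ∀ h a, ((1 : Matrix (Fin dx) (Fin dx) ℂ).submatrix (fun a => e (h, a)) id *ᵥ x j) a
      = x j (e (h, a)) := fun h a => congrFun (Matrix.one_mulVec (x j)) (e (h, a))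
  have hO : ∀ h, ((1 : Matrix (Fin dx) (Fin dx) ℂ).submatrix id (fun a => e (h, a)) *ᵥ
      ((1 : Matrix (Fin dx) (Fin dx) ℂ).submatrix (fun a => e (h, a)) id *ᵥ x j)) k
      = ∑ a, if k = e (h, a) then x j (e (h, a)) else 0 := fun h => by
    simp [Matrix.mulVec, dotProduct, Matrix.one_apply]
  simp only [copyHead, single_one_mulVec_apply, hx, Finset.sum_apply, Pi.smul_apply, hO]
  simp only [mul_ite, mul_one, mul_zero, Finset.sum_ite_eq', Finset.mem_univ, if_true,
    smul_eq_mul, one_mul]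
  have key := Fintype.sum_prod_type' (fun h a => if k = e (h, a) then x j (e (h, a)) else 0)
  rw [← key, e.sum_comp (fun q => if k = q then x j q else 0)]
  simp

lemma saLayerC_bilinHead {N H da dx : ℕ} {κ : Type*} [Fintype κ] (e : Fin H × Fin da ≃ κ)
    (a₀ : Fin da) (P R : Matrix κ (Fin dx) ℂ) (c p : Fin dx) (s : Fin dx → ℂ) :
    saLayerC (bilinHead e a₀ P R c p) (fun _ : Fin N => s) =
      fun _ => Pi.single p (N * ((P *ᵥ s) ⬝ᵥ (R *ᵥ s)) * s c) := by
  funext i k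
  have hsub : ∀ (A : Matrix κ (Fin dx) ℂ) h a,
      (A.submatrix (fun a => e (h, a)) id *ᵥ s) a = (A *ᵥ s) (e (h, a)) := fun _ _ _ => rfl
  have key := Fintype.sum_prod_type' (fun h a => (P *ᵥ s) (e (h, a)) * (R *ᵥ s) (e (h, a)))
  rw [e.sum_comp (fun q => (P *ᵥ s) q * (R *ᵥ s) q)] at key
  simp only [saLayerC, bilinHead, hsub, Finset.sum_apply, Pi.smul_apply, single_one_mulVec_apply,
    if_true, smul_eq_mul, ← Finset.sum_mul, Pi.single_apply, dotProduct]
  rw [← key]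
  by_cases hk : k = p <;> simp [hk, mul_assoc]

/-- Iterating the layers that cube coordinate `p`. -/
lemma exists_saNetAuxC_cube {N H da dx L : ℕ} (hN : N ≠ 0) (e : Fin H × Fin da ≃ Fin dx)
    (a₀ : Fin da) (p : Fin dx) (W : ℕ → Fin H → HeadWeightsC da dx)
    (hW : ∀ l, 2 ≤ l → l < L →
      W l = bilinHead e a₀ (Matrix.single p p 1) (Matrix.single p p 1) p p)
    (c₀ : ℂ) (hc₀ : c₀ ≠ 0) (l : ℕ) (hl : l + 2 ≤ L) :
    ∃ c : ℂ, c ≠ 0 ∧ ∀ (x : Fin N → Fin dx → ℂ) (g : ℂ),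
      saNetAuxC W 2 x = (fun _ => Pi.single p (c₀ * g)) →
      saNetAuxC W (l + 2) x = fun _ => Pi.single p (c * g ^ 3 ^ l) := by
  induction l with
  | zero => exact ⟨c₀, hc₀, fun x g h => by simpa using h⟩
  | succ l ih =>
    obtain ⟨c, hc, hnet⟩ := ih (by omega)
    refine ⟨N * c ^ 3, by simp [hN, hc], fun x g h => ?_⟩
    have hstep : saNetAuxC W (l + 1 + 2) x = saLayerC (W (l + 2)) (saNetAuxC W (l + 2) x) := rfl
    rw [hstep, hnet x g h, hW (l + 2) (by omega) (by omega), saLayerC_bilinHead]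
    funext _
    congr 1
    simp only [dotProduct, single_one_mulVec_apply]
    simp only [mul_ite, mul_zero, ite_mul, zero_mul, Pi.single_eq_same, Finset.sum_ite_eq',
      Finset.mem_univ, if_true]
    ring

/-- The template vectors: the rows of `V` in the first block of coordinates, then the rows of `V`
in the second block, then a vector vanishing on both blocks. The last block is constantly `1`. -/
noncomputable def gramTemplate {n D r : ℕ} (V : Matrix (Fin n) (Fin D) ℝ) (m : ℕ) :
    Fin D ⊕ Fin D ⊕ Fin r → ℝ :=
  Sum.elim (fun q => if h : m < n then V ⟨m, h⟩ q else 0)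
    (Sum.elim (fun q => if h : n ≤ m ∧ m < n + n then V ⟨m - n, by omega⟩ q else 0) 1)

lemma sum_gramTemplate {N n D r : ℕ} (V : Matrix (Fin n) (Fin D) ℝ) {i₁ i₂ : Fin N}
    (hne : i₁ ≠ i₂) (a b : Fin n) (t : Fin N → ℕ) (h₁ : t i₁ = a) (h₂ : t i₂ = n + b)
    (h₃ : ∀ j, j ≠ i₁ → j ≠ i₂ → n + n ≤ t j) :
    ∑ j, gramTemplate (r := r) V (t j) = Sum.elim (V a) (Sum.elim (V b) fun _ => (N : ℝ)) := by
  funext k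
  rw [Finset.sum_apply]
  rcases k with q | q | q
  · rw [Finset.sum_eq_single i₁]
    · simp [gramTemplate, h₁]
    · intro j _ hj
      have : ¬ t j < n := by
        by_cases hj2 : j = i₂
        · subst hj2; omega
        · have := h₃ j hj hj2; omega
      simp [gramTemplate, this]
    · simp
  · rw [Finset.sum_eq_single i₂]
    · simp [gramTemplate, h₂]
    · intro j _ hj
      have : ¬ (n ≤ t j ∧ t j < n + n) := by
        by_cases hj1 : j = i₁
        · subst hj1; omega
        · have := h₃ j hj1 hj; omega
      simp only [gramTemplate, Sum.elim_inr, Sum.elim_inl, dif_neg this]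
    · simp
  · simp [gramTemplate]

/-- Lemma 5 of the paper, weight assignment realizing Hadamard powers of
Gram matrices: for any balanced partition `(I,J)` of `[N]`, any even `M ≥ 2` and any
`V ∈ ℝ^{(M/2)×((d_x−H)/2)}` with ℓ²-normalized rows, there are `M+1` real template vectors
and a (complex) weight assignment such that the `(M/2)×(M/2)` submatrix of the matricized
grid tensor of `y_p^{i,L,d_x,H,Θ}` — rows: index tuples whose first `I`-coordinate ranges
over `[M/2]` and all other coordinates equal `M+1`; columns: index tuples whose first
`J`-coordinate ranges over `{M/2+1,…,M}` and all other coordinates equal `M+1` — equals a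
nonzero constant times `(V Vᵀ)^{⊙3^{L−2}}` (the entrywise `3^{L−2}`-th power). -/
theorem weight_assignment_hadamard_power
    {L H da dx N M : ℕ}
    (hL : 2 ≤ L) (hN : 1 < N) (hNeven : Even N)
    (hdxda : dx = H * da) (hda : Odd da)
    (hM : 2 ≤ M) (hMeven : Even M)
    (I J : Finset (Fin N)) (hIJ : Disjoint I J) (hIJcov : I ∪ J = Finset.univ)
    (hI : I.card = N / 2) (hJ : J.card = N / 2)
    (V : Matrix (Fin (M / 2)) (Fin ((dx - H) / 2)) ℝ)
    (hV : ∀ a, ∑ q, V a q ^ 2 = 1)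
    (i : Fin N) (p : Fin dx) :
    ∃ (x : Fin (M + 1) → Fin dx → ℝ)
      (Θ : Fin L → Fin H → HeadWeightsC da dx) (const : ℂ), const ≠ 0 ∧
      ∀ a b : Fin (M / 2),
        saOutputC L N Θ i p
            (fun j q =>
              ((x (if j = I.min' (Finset.card_pos.mp (by rw [hI]; omega)) then
                      (⟨a.val, by have := a.isLt; omega⟩ : Fin (M + 1))
                    else if j = J.min' (Finset.card_pos.mp (by rw [hJ]; omega)) then
                      (⟨M / 2 + b.val, by have := b.isLt; omega⟩ : Fin (M + 1))
                    else Fin.last M) q : ℂ))) =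
          const * ((((V * Vᵀ) a b : ℝ) : ℂ)) ^ (3 ^ (L - 2)) := by
  subst hdxda
  have hda0 : 0 < da := hda.pos
  have hH : 0 < H := Nat.pos_of_mul_pos_right (lt_of_le_of_lt (Nat.zero_le _) p.isLt)
  have hHle : H ≤ H * da := Nat.le_mul_of_pos_right H hda0
  have hne : I.min' (Finset.card_pos.mp (by rw [hI]; omega)) ≠
      J.min' (Finset.card_pos.mp (by rw [hJ]; omega)) :=
    Finset.disjoint_iff_ne.mp hIJ _ (Finset.min'_mem _ _) _ (Finset.min'_mem _ _)
  generalize I.min' (Finset.card_pos.mp (by rw [hI]; omega)) = i₁ at *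
  generalize J.min' (Finset.card_pos.mp (by rw [hJ]; omega)) = i₂ at *
  generalize hD : (H * da - H) / 2 = D at V
  obtain ⟨r, hr⟩ : ∃ r, H * da = D + (D + (r + 1)) := ⟨H * da - 2 * D - 1, by omega⟩
  let f : Fin D ⊕ Fin D ⊕ Fin (r + 1) ≃ Fin (H * da) :=
    ((Equiv.refl _).sumCongr finSumFinEquiv).trans (finSumFinEquiv.trans (finCongr hr.symm))
  let e : Fin H × Fin da ≃ Fin (H * da) := finProdFinEquiv
  let a₀ : Fin da := ⟨0, hda0⟩
  let c : Fin (H * da) := f (Sum.inr (Sum.inr 0))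
  let P : Matrix (Fin D ⊕ Fin D ⊕ Fin (r + 1)) (Fin (H * da)) ℂ :=
    Matrix.of (Sum.elim (fun q => Pi.single (f (Sum.inl q)) 1) 0)
  let R : Matrix (Fin D ⊕ Fin D ⊕ Fin (r + 1)) (Fin (H * da)) ℂ :=
    Matrix.of (Sum.elim (fun q => Pi.single (f (Sum.inr (Sum.inl q))) 1) 0)
  let W : ℕ → Fin H → HeadWeightsC da (H * da)
    | 0 => copyHead e a₀ c
    | 1 => bilinHead (e.trans f.symm) a₀ P R c p
    | _ + 2 => bilinHead e a₀ (Matrix.single p p 1) (Matrix.single p p 1) p p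
  let Θ : Fin L → Fin H → HeadWeightsC da (H * da) := fun l => W l
  have hΘ : ∀ l, l < L → extendWC Θ l = W l := fun l hl => by simp [extendWC, hl, Θ]
  have hN0 : N ≠ 0 := by omega
  have hNC : (N : ℂ) ≠ 0 := Nat.cast_ne_zero.mpr hN0
  obtain ⟨const, hconst, hnet⟩ := exists_saNetAuxC_cube (L := L) hN0 e a₀ p (extendWC Θ)
    (fun l h2 hl => by obtain ⟨k, rfl⟩ := Nat.exists_eq_add_of_le' h2; exact hΘ _ hl)
    (N * N) (mul_ne_zero hNC hNC) (L - 2) (by omega)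
  refine ⟨fun m q => gramTemplate V m (f.symm q), Θ, const, hconst, fun a b => ?_⟩
  rw [Nat.sub_add_cancel hL] at hnet
  unfold saOutputC
  rw [hnet _ (((V * Vᵀ) a b : ℝ) : ℂ)]
  · exact Pi.single_eq_same p _
  let t : Fin N → Fin (M + 1) := fun j =>
    if j = i₁ then ⟨a.val, by have := a.isLt; omega⟩
    else if j = i₂ then ⟨M / 2 + b.val, by have := b.isLt; omega⟩ else Fin.last M
  have hsum := sum_gramTemplate (r := r + 1) V hne a b (fun j => (t j : ℕ)) (by simp [t])
    (by simp [t, hne.symm]) (fun j h1 h2 => by simp [t, h1, h2]; omega)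
  change saLayerC (extendWC Θ 1) (saLayerC (extendWC Θ 0)
    (fun j q => ((gramTemplate V (t j) (f.symm q) : ℝ) : ℂ))) = _
  rw [hΘ 0 (by omega), hΘ 1 (by omega)]
  change saLayerC (bilinHead (e.trans f.symm) a₀ P R c p) (saLayerC (copyHead e a₀ c) _) = _
  rw [saLayerC_copyHead e a₀ c _ (fun j => by simp [c, gramTemplate]), saLayerC_bilinHead]
  have hs : ∀ k, (∑ j, fun q => ((gramTemplate (r := r + 1) V (t j) (f.symm q) : ℝ) : ℂ)) (f k) =
      ((Sum.elim (V a) (Sum.elim (V b) fun _ => (N : ℝ)) k : ℝ) : ℂ) := fun k => by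
    rw [← hsum]; simp
  generalize (∑ j, fun q => ((gramTemplate (r := r + 1) V (t j) (f.symm q) : ℝ) : ℂ)) = s at hs ⊢
  have hPR : (P *ᵥ s) ⬝ᵥ (R *ᵥ s) = (((V * Vᵀ) a b : ℝ) : ℂ) := by
    simp [dotProduct, Matrix.mulVec, P, R, Pi.single_apply, hs, Matrix.mul_apply]
  funext _
  congr 1
  rw [hPR, hs]
  simp only [Sum.elim_inr, Complex.ofReal_natCast]
  ring
end
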